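/- arXiv:1302.2252 — 5 statements merged into one kernel-verified Lean document; each statement's English description precedes it below -/
import Mathlib

section
/- Let x ∈ ℝ^d with x ≠ 0, let 0 < r ≤ 1, and let v be a unit vector in ℝ^d. Suppose t ≥ 0 is such that t·v lies in the closed ball B̄(x, r·‖x‖₂) and t ≤ ‖x‖₂. Then for every s ∈ [t, ‖x‖₂], the point s·v belongs to B̄(x·√(1−r²), r·‖x‖₂) ∪ B̄(x, r·‖x‖₂). In particular, if the ray {t·v : t ≥ 0} meets B̄(x, r·‖x‖₂), then ‖x‖₂·v belongs to B̄(x·√(1−r²), r·‖x‖₂) ∪ B̄(x, r·‖x‖₂). -/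
open Metric

/-- A point `s • v` on the line through a unit vector `v` lies in the ball of center `a • x` and
radius `r * ‖x‖` iff the corresponding quadratic inequality in `s` holds. -/
theorem smul_mem_closedBall_smul_iff {E : Type*} [NormedAddCommGroup E] [InnerProductSpace ℝ E]
    {x v : E} (hv : ‖v‖ = 1) {r : ℝ} (hr : 0 ≤ r) (a s : ℝ) :
    s • v ∈ closedBall (a • x) (r * ‖x‖) ↔
      s ^ 2 - 2 * s * a * inner ℝ x v + a ^ 2 * ‖x‖ ^ 2 ≤ r ^ 2 * ‖x‖ ^ 2 := by
  have expand : ‖s • v - a • x‖ ^ 2 =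
      s ^ 2 - 2 * s * a * inner ℝ x v + a ^ 2 * ‖x‖ ^ 2 := by
    rw [norm_sub_sq_real, norm_smul, norm_smul, real_inner_smul_left, real_inner_smul_right,
      real_inner_comm, hv, mul_pow, mul_pow, Real.norm_eq_abs, Real.norm_eq_abs, sq_abs, sq_abs]
    ring
  rw [mem_closedBall, dist_eq_norm, ← sq_le_sq₀ (norm_nonneg _) (by positivity), expand, mul_pow]

/-- If `s ↦ s² - 2sp + c²n²` is nonpositive at some `t ≥ 0`, then `c = 0` or `c * n ≤ p`. -/
theorem eq_zero_or_mul_le_of_quadratic_nonpos {n p c t : ℝ} (hn : 0 < n) (ht : 0 ≤ t)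
    (h : t ^ 2 - 2 * t * p + c ^ 2 * n ^ 2 ≤ 0) : c = 0 ∨ c * n ≤ p := by
  rcases ht.eq_or_lt with rfl | ht
  · left
    have hcn : (c * n) ^ 2 = 0 := le_antisymm (by linarith [mul_pow c n 2]) (sq_nonneg _)
    simpa [hn.ne'] using hcn
  · right
    by_contra! hlt
    nlinarith [sq_nonneg (t - c * n), mul_lt_mul_of_pos_left hlt ht]

/-- The quadratic describing the ball around `c • x` is nonpositive between `p` and `n`. -/
theorem quadratic_nonpos_of_mem_Icc {n p c s : ℝ} (hc₀ : 0 ≤ c) (hc₁ : c ≤ 1)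
    (hn : 0 < n) (hcp : c * n ≤ p) (hps : p < s) (hsn : s ≤ n) :
    s ^ 2 - 2 * s * c * p + c ^ 2 * n ^ 2 ≤ (1 - c ^ 2) * n ^ 2 := by
  have hp : 0 ≤ p := (mul_nonneg hc₀ hn.le).trans hcp
  have at_p : p ^ 2 - 2 * p * c * p + c ^ 2 * n ^ 2 - (1 - c ^ 2) * n ^ 2 ≤ 0 := by
    have hp_sq : p ^ 2 ≤ n ^ 2 := pow_le_pow_left₀ hp (hps.le.trans hsn) 2
    have hcp_sq : (c * n) ^ 2 ≤ p ^ 2 := pow_le_pow_left₀ (mul_nonneg hc₀ hn.le) hcp 2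
    rcases le_total 0 (1 - 2 * c) with h | h
    · nlinarith [mul_le_mul_of_nonneg_left hp_sq h,
        mul_nonneg (mul_nonneg hc₀ (sub_nonneg.2 hc₁)) (sq_nonneg n)]
    · nlinarith [mul_le_mul_of_nonpos_left hcp_sq h,
        mul_nonneg (mul_nonneg (sq_nonneg (1 - c)) (by linarith : 0 ≤ 2 * c + 1)) (sq_nonneg n)]
  have at_n : n ^ 2 - 2 * n * c * p + c ^ 2 * n ^ 2 - (1 - c ^ 2) * n ^ 2 ≤ 0 := by
    nlinarith [mul_nonneg (mul_nonneg hn.le hc₀) (sub_nonneg.2 hcp)]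
  have hpn : 0 < n - p := by linarith
  have chord : (n - p) * (s ^ 2 - 2 * s * c * p + c ^ 2 * n ^ 2 - (1 - c ^ 2) * n ^ 2) =
      (n - s) * (p ^ 2 - 2 * p * c * p + c ^ 2 * n ^ 2 - (1 - c ^ 2) * n ^ 2) +
      (s - p) * (n ^ 2 - 2 * n * c * p + c ^ 2 * n ^ 2 - (1 - c ^ 2) * n ^ 2) -
      (n - p) * ((s - p) * (n - s)) := by ring
  have h₁ := mul_nonpos_of_nonneg_of_nonpos (sub_nonneg.2 hsn) at_p
  have h₂ := mul_nonpos_of_nonneg_of_nonpos (sub_nonneg.2 hps.le) at_n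
  have h₃ := mul_nonneg hpn.le (mul_nonneg (sub_nonneg.2 hps.le) (sub_nonneg.2 hsn))
  exact sub_nonpos.1 (nonpos_of_mul_nonpos_right (chord.trans_le (by linarith)) hpn)

/-- The geometric step in the proof of the main theorem: for `x ≠ 0`, `0 < r ≤ 1` and a unit
vector `v`, if some point `t·v` of the ray through `v` with `0 ≤ t ≤ ‖x‖₂` lies in
`B̄(x, r‖x‖₂)`, then the whole segment from `t·v` to `‖x‖₂·v` is contained in
`B̄(x√(1−r²), r‖x‖₂) ∪ B̄(x, r‖x‖₂)`. In particular, if the ray through `v` meets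
`B̄(x, r‖x‖₂)`, then `‖x‖₂·v` belongs to this union. -/
theorem segment_subset_union_of_shifted_balls (d : ℕ) (x : EuclideanSpace ℝ (Fin d)) (hx : x ≠ 0)
    (r : ℝ) (hr₀ : 0 < r) (hr₁ : r ≤ 1) (v : EuclideanSpace ℝ (Fin d)) (hv : ‖v‖ = 1) :
    (∀ t : ℝ, 0 ≤ t → t • v ∈ closedBall x (r * ‖x‖) → t ≤ ‖x‖ →
      ∀ s ∈ Set.Icc t ‖x‖,
        s • v ∈ closedBall (Real.sqrt (1 - r ^ 2) • x) (r * ‖x‖) ∪ closedBall x (r * ‖x‖)) ∧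
    ((∃ t : ℝ, 0 ≤ t ∧ t • v ∈ closedBall x (r * ‖x‖)) →
      ‖x‖ • v ∈ closedBall (Real.sqrt (1 - r ^ 2) • x) (r * ‖x‖) ∪ closedBall x (r * ‖x‖)) := by
  have hn : 0 < ‖x‖ := norm_pos_iff.2 hx
  have hc_sq : Real.sqrt (1 - r ^ 2) ^ 2 = 1 - r ^ 2 := Real.sq_sqrt (by nlinarith)
  have hc₀ := Real.sqrt_nonneg (1 - r ^ 2)
  have hc₁ : Real.sqrt (1 - r ^ 2) ≤ 1 := Real.sqrt_le_one.2 (by nlinarith)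
  have mem_shifted := smul_mem_closedBall_smul_iff (x := x) hv hr₀.le (Real.sqrt (1 - r ^ 2))
  have mem_ball := smul_mem_closedBall_smul_iff (x := x) hv hr₀.le 1
  rw [one_smul] at mem_ball
  simp only [Set.mem_union, mem_shifted, mem_ball]
  generalize Real.sqrt (1 - r ^ 2) = c at *
  generalize inner ℝ x v = p at *
  generalize ‖x‖ = n at *
  have hr_sq : r ^ 2 = 1 - c ^ 2 := by linarith
  rw [hr_sq]
  have dichotomy : ∀ t : ℝ, 0 ≤ t →
      t ^ 2 - 2 * t * 1 * p + 1 ^ 2 * n ^ 2 ≤ (1 - c ^ 2) * n ^ 2 → c = 0 ∨ c * n ≤ p :=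
    fun t ht h => eq_zero_or_mul_le_of_quadratic_nonpos hn ht (by linarith)
  constructor
  · intro t ht htb htn s ⟨hts, hsn⟩
    rcases dichotomy t ht htb with rfl | hcp
    · left
      nlinarith
    · rcases le_or_gt s p with hsp | hps
      · right
        nlinarith [mul_nonneg (sub_nonneg.2 hts) (by linarith : 0 ≤ 2 * p - s - t)]
      · exact Or.inl (quadratic_nonpos_of_mem_Icc hc₀ hc₁ hn hcp hps hsn)
  · rintro ⟨t, ht, htb⟩
    left
    rcases dichotomy t ht htb with rfl | hcp
    · linarith
    · nlinarith [mul_nonneg (mul_nonneg hn.le hc₀) (sub_nonneg.2 hcp)]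
end

section
/- Let d ≥ 1 and let μ be the radial measure on ℝ^d given by dμ(y) = μ₀(‖y‖₂) dy, where μ₀ : (0,∞) → [0,∞) is measurable, not zero almost everywhere, and μ₀(t)·t^{d−1} is locally integrable on (0,∞). Suppose there exists C > 0 such that for all x ∈ ℝ^d and all 0 < r ≤ 1, μ(B(x·√(1−r²), r·‖x‖₂)) ≤ C · μ(B(x, r·‖x‖₂)). Let γ₀ be the measure on (0,∞) given by dγ₀(t) = μ₀(t)·t^{d−1} dt. Then for every radial f ∈ L¹(ℝ^d, μ) with radial profile f₀ (i.e., f(x) = f₀(‖x‖₂) for x ≠ 0) and every x ≠ 0, the pointwise bound M_μ f(x) ≤ (C+1) · M^u_{γ₀} f₀(‖x‖₂) holds. -/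
open MeasureTheory Metric

/-- The centered Hardy–Littlewood maximal operator associated to a Borel measure `μ` on
`ℝ^d`, defined with closed Euclidean balls:
`M_μ f (x) = sup { (1/μ(B̄(x,r))) ∫_{B̄(x,r)} |f| dμ : r > 0, μ(B̄(x,r)) > 0 }`. -/
noncomputable def centeredMaximal {d : ℕ} (μ : Measure (EuclideanSpace ℝ (Fin d)))
    (f : EuclideanSpace ℝ (Fin d) → ℝ) (x : EuclideanSpace ℝ (Fin d)) : ENNReal :=
  ⨆ (r : ℝ) (_ : 0 < r) (_ : 0 < μ (closedBall x r)),
    (μ (closedBall x r))⁻¹ * ∫⁻ y in closedBall x r, ENNReal.ofReal |f y| ∂μ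

/-- A function on `ℝ^d` is radial if it only depends on the distance to the origin. -/
def IsRadial {d : ℕ} (f : EuclideanSpace ℝ (Fin d) → ℝ) : Prop :=
  ∃ f₀ : ℝ → ℝ, ∀ x : EuclideanSpace ℝ (Fin d), x ≠ 0 → f x = f₀ ‖x‖

/-- The measure on `ℝ^d` with density `‖x‖₂^{-α}` with respect to Lebesgue measure. -/
noncomputable def muAlpha (d : ℕ) (α : ℝ) : Measure (EuclideanSpace ℝ (Fin d)) :=
  (volume : Measure (EuclideanSpace ℝ (Fin d))).withDensity
    (fun x => ENNReal.ofReal (‖x‖ ^ (-α)))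

/-- The uncentered maximal operator on `(0,∞)` with respect to a Borel measure `ν` on `ℝ`:
the supremum of the averages of `|f|` over all bounded open intervals `I ⊆ (0,∞)` containing `x`
and of positive measure. -/
noncomputable def uncenteredMaximalPos (ν : Measure ℝ) (f : ℝ → ℝ) (x : ℝ) : ENNReal :=
  ⨆ (a : ℝ) (b : ℝ) (_ : 0 ≤ a) (_ : x ∈ Set.Ioo a b) (_ : 0 < ν (Set.Ioo a b)),
    (ν (Set.Ioo a b))⁻¹ * ∫⁻ y in Set.Ioo a b, ENNReal.ofReal |f y| ∂ν

section

open Set Filter Topology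
open scoped ENNReal

section Polar

variable {E : Type*} [NormedAddCommGroup E] [NormedSpace ℝ E] [MeasurableSpace E] [BorelSpace E]
  [FiniteDimensional ℝ E] [Nontrivial E]

/-- Integration in polar coordinates for the Lebesgue integral. -/
theorem lintegral_eq_lintegral_toSphere (ν : Measure E) [ν.IsAddHaarMeasure] {F : E → ℝ≥0∞}
    (hF : Measurable F) :
    ∫⁻ y, F y ∂ν = ∫⁻ θ : sphere (0 : E) 1, (∫⁻ t in Ioi (0 : ℝ),
      ENNReal.ofReal (t ^ (Module.finrank ℝ E - 1)) * F (t • (θ : E))) ∂ν.toSphere := by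
  have hG : Measurable fun p : sphere (0 : E) 1 × Ioi (0 : ℝ) => F ((p.2 : ℝ) • (p.1 : E)) := by
    fun_prop
  calc ∫⁻ y, F y ∂ν = ∫⁻ y : ({0}ᶜ : Set E), F y ∂(ν.comap (↑)) := by
        rw [lintegral_subtype_comap (measurableSet_singleton _).compl, restrict_compl_singleton]
    _ = ∫⁻ p, F ((p.2 : ℝ) • (p.1 : E))
          ∂ν.toSphere.prod (Measure.volumeIoiPow (Module.finrank ℝ E - 1)) := by
        rw [← ν.measurePreserving_homeomorphUnitSphereProd.lintegral_comp hG]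
        refine lintegral_congr fun y => ?_
        have hy : ‖(y : E)‖ ≠ 0 := norm_ne_zero_iff.2 y.2
        simp [smul_smul, hy]
    _ = _ := by
        rw [lintegral_prod _ hG.aemeasurable]
        refine lintegral_congr fun θ => ?_
        rw [Measure.volumeIoiPow, lintegral_withDensity_eq_lintegral_mul _ (by fun_prop)
          (by fun_prop), ← lintegral_subtype_comap measurableSet_Ioi]
        rfl

/-- A measure with radial density is the image of the product of the surface measure of the sphere
with the corresponding weighted measure on `(0, ∞)`. -/
theorem map_smul_toSphere_prod (ν : Measure E) [ν.IsAddHaarMeasure] {w : ℝ → ℝ}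
    (hw : Measurable w) :
    (ν.toSphere.prod ((volume.withDensity fun t =>
        ENNReal.ofReal (w t * t ^ (Module.finrank ℝ E - 1))).restrict (Ioi (0 : ℝ)))).map
      (fun p => p.2 • (p.1 : E)) = ν.withDensity fun y => ENNReal.ofReal (w ‖y‖) := by
  have hp : Measurable fun p : sphere (0 : E) 1 × ℝ => p.2 • (p.1 : E) := by fun_prop
  refine Measure.ext fun s hs => ?_
  have hs1 : Measurable (s.indicator (1 : E → ℝ≥0∞)) := measurable_one.indicator hs
  rw [← lintegral_indicator_one hs, lintegral_map hs1 hp, lintegral_prod _ (by fun_prop),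
    ← lintegral_indicator_one hs, lintegral_withDensity_eq_lintegral_mul _ (by fun_prop) hs1,
    lintegral_eq_lintegral_toSphere ν (by fun_prop)]
  refine lintegral_congr fun θ => ?_
  rw [restrict_withDensity measurableSet_Ioi, lintegral_withDensity_eq_lintegral_mul _
    (by fun_prop) (by fun_prop)]
  refine setLIntegral_congr_fun measurableSet_Ioi fun t ht => ?_
  have ht : 0 < t := ht
  have hn : ‖t • (θ : E)‖ = t := by simp [norm_smul, abs_of_pos ht]
  simp only [Pi.mul_apply, hn, mul_comm (w t), ENNReal.ofReal_mul (pow_nonneg ht.le _), mul_assoc]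

end Polar

theorem setLIntegral_Icc_le_uncenteredMaximalPos_mul {γ : Measure ℝ} [IsFiniteMeasureOnCompacts γ]
    (hγ : γ (Iic 0) = 0) (g : ℝ → ℝ) {a b ρ : ℝ} (hρ : 0 < ρ) (hab : ρ ∈ Icc a b) :
    ∫⁻ t in Icc a b, ENNReal.ofReal |g t| ∂γ ≤ uncenteredMaximalPos γ g ρ * γ (Icc a b) := by
  set A := uncenteredMaximalPos γ g ρ with hA
  rcases eq_or_ne (γ (Icc a b)) 0 with h0 | h0
  · rw [setLIntegral_measure_zero _ _ h0]
    exact zero_le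
  have key : ∀ ε > 0, ∫⁻ t in Icc a b, ENNReal.ofReal |g t| ∂γ
      ≤ A * γ (cthickening ε (Icc a b)) := by
    intro ε hε
    set I := Ioo (max (a - ε) 0) (b + ε)
    have hsub : (Icc a b : Set ℝ) ≤ᵐ[γ] I := by
      have : ∀ᵐ t ∂γ, t ∉ Iic (0 : ℝ) := measure_eq_zero_iff_ae_notMem.1 hγ
      filter_upwards [this] with t ht hab
      have ht : 0 < t := not_le.1 ht
      exact ⟨max_lt (by linarith [hab.1]) ht, by linarith [hab.2]⟩
    have hsub' : I ⊆ cthickening ε (Icc a b) := by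
      intro t ht
      have h1 := (le_max_left _ _).trans_lt ht.1
      have h2 := ht.2
      rcases le_total t a with h | h
      · exact mem_cthickening_of_dist_le t a _ _ ⟨le_rfl, hab.1.trans hab.2⟩
          (by rw [Real.dist_eq, abs_le]; constructor <;> linarith)
      rcases le_total t b with h' | h'
      · exact self_subset_cthickening _ ⟨h, h'⟩
      · exact mem_cthickening_of_dist_le t b _ _ ⟨hab.1.trans hab.2, le_rfl⟩
          (by rw [Real.dist_eq, abs_le]; constructor <;> linarith)
    have hI0 : γ I ≠ 0 := fun h => h0 (measure_mono_null_ae hsub h)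
    have hItop : γ I ≠ ∞ := measure_Ioo_lt_top.ne
    have hρI : ρ ∈ I := ⟨max_lt (by linarith [hab.1]) hρ, by linarith [hab.2]⟩
    have hIA : (γ I)⁻¹ * ∫⁻ t in I, ENNReal.ofReal |g t| ∂γ ≤ A := by
      rw [hA, uncenteredMaximalPos]
      exact le_iSup₂_of_le _ _ <| le_iSup₂_of_le (le_max_right _ _) hρI <|
        le_iSup_of_le (pos_iff_ne_zero.2 hI0) le_rfl
    calc ∫⁻ t in Icc a b, ENNReal.ofReal |g t| ∂γ ≤ ∫⁻ t in I, ENNReal.ofReal |g t| ∂γ :=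
          lintegral_mono' (Measure.restrict_mono_ae hsub) le_rfl
      _ ≤ γ I * A := (ENNReal.inv_mul_le_iff hI0 hItop).1 hIA
      _ ≤ _ := by rw [mul_comm]; gcongr
  have hlim : Tendsto (fun ε => A * γ (cthickening ε (Icc a b))) (𝓝[>] 0) (𝓝 (A * γ (Icc a b))) :=
    ENNReal.Tendsto.const_mul
      ((tendsto_measure_cthickening_of_isCompact isCompact_Icc).mono_left nhdsWithin_le_nhds)
      (Or.inl h0)
  exact ge_of_tendsto hlim (eventually_nhdsWithin_of_forall key)

section Geometry

variable {E : Type*} [NormedAddCommGroup E] [InnerProductSpace ℝ E]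

theorem norm_smul_sub_smul_sq {θ : E} (hθ : ‖θ‖ = 1) (x : E) (t c : ℝ) :
    ‖t • θ - c • x‖ ^ 2 = t ^ 2 - 2 * (t * c * inner ℝ θ x) + c ^ 2 * ‖x‖ ^ 2 := by
  rw [norm_sub_sq_real, norm_smul, norm_smul, hθ, real_inner_smul_left, real_inner_smul_right,
    mul_pow, mul_pow, Real.norm_eq_abs, Real.norm_eq_abs, sq_abs, sq_abs]
  ring

/-- If the ray through `θ` meets `closedBall x s`, then the part of the ray at distance between
`c * ‖x‖` and `‖x‖` from the origin lies in the shifted ball, and its first endpoint lies in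
`closedBall x s`. Here `r = min (s / ‖x‖) 1` and `c = √(1 - r ^ 2)`. -/
theorem ray_segment_subset_shifted_closedBall {θ x : E} (hθ : ‖θ‖ = 1) (hx : x ≠ 0)
    {r s t : ℝ} (hr : r = min (s / ‖x‖) 1) (hs : 0 < s) (ht : 0 < t)
    (hts : t • θ ∈ closedBall x s) :
    (√(1 - r ^ 2) * ‖x‖) • θ ∈ closedBall x s ∧
      ∀ u ∈ Icc (√(1 - r ^ 2) * ‖x‖) ‖x‖, u • θ ∈ closedBall (√(1 - r ^ 2) • x) (r * ‖x‖) := by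
  have hρ : 0 < ‖x‖ := norm_pos_iff.2 hx
  have hr0 : 0 < r := hr ▸ lt_min (div_pos hs hρ) one_pos
  have hr1 : r ≤ 1 := hr ▸ min_le_right _ _
  have hrs : r * ‖x‖ ≤ s := by
    rw [← le_div_iff₀ hρ, hr]; exact min_le_left _ _
  have hc2 : √(1 - r ^ 2) ^ 2 = 1 - r ^ 2 := Real.sq_sqrt (by nlinarith)
  have hc0 : 0 ≤ √(1 - r ^ 2) := Real.sqrt_nonneg _
  set c := √(1 - r ^ 2)
  set ρ := ‖x‖
  set m : ℝ := inner ℝ θ x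
  have hc1 : c ≤ 1 := by nlinarith
  have hcm : c * (c * ρ) ≤ c * m := by
    rcases le_or_gt 1 (s / ρ) with h | h
    · rw [min_eq_right h] at hr
      have : c = 0 := by
        rw [hr] at hc2
        exact pow_eq_zero_iff two_ne_zero |>.1 (by linarith)
      simp [this]
    · rw [min_eq_left h.le] at hr
      have hs' : s = r * ρ := by rw [hr]; field_simp
      have h2 := pow_le_pow_left₀ (norm_nonneg (t • θ - x)) (mem_closedBall_iff_norm.1 hts) 2
      have h3 := norm_smul_sub_smul_sq hθ x t 1
      rw [one_smul] at h3
      have h4 : (c * ρ) ^ 2 = ρ ^ 2 - (r * ρ) ^ 2 := by rw [mul_pow, hc2]; ring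
      rw [h3, hs'] at h2
      refine mul_le_mul_of_nonneg_left ?_ hc0
      refine le_of_mul_le_mul_left ?_ ht
      nlinarith [sq_nonneg (t - c * ρ)]
  constructor
  · rw [mem_closedBall_iff_norm]
    refine le_trans (abs_le_of_sq_le_sq' ?_ (by positivity)).2 hrs
    have h3 := norm_smul_sub_smul_sq hθ x (c * ρ) 1
    rw [one_smul] at h3
    rw [h3]
    nlinarith [mul_le_mul_of_nonneg_left hcm hρ.le]
  · rintro u ⟨hu1, hu2⟩
    rw [mem_closedBall_iff_norm]
    refine (abs_le_of_sq_le_sq' ?_ (by positivity)).2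
    have hu0 : 0 ≤ u := le_trans (by positivity) hu1
    rw [norm_smul_sub_smul_sq hθ x u c]
    have h5 := mul_le_mul_of_nonneg_left hcm hu0
    have h6 : 0 ≤ (ρ - u) * (u + ρ - 2 * c ^ 2 * ρ) := by
      refine mul_nonneg (by linarith) ?_
      have h7 : c ^ 2 ≤ c := by nlinarith
      have h8 : c ^ 2 * ρ ≤ c * ρ := by gcongr
      have h9 : c * ρ ≤ ρ := by nlinarith
      linarith
    have : r ^ 2 * ρ ^ 2 = (1 - c ^ 2) * ρ ^ 2 := by rw [hc2]; ring
    nlinarith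

theorem isCompact_ray_slice {θ : E} (hθ : ‖θ‖ = 1) (x : E) (s : ℝ) :
    IsCompact {t : ℝ | t • θ ∈ closedBall x s} := by
  refine Metric.isCompact_of_isClosed_isBounded (isClosed_closedBall.preimage (by fun_prop)) ?_
  refine isBounded_iff_forall_norm_le.2 ⟨‖x‖ + s, fun t ht => ?_⟩
  have := norm_le_of_mem_closedBall ht
  rwa [norm_smul, hθ, mul_one] at this

theorem convex_ray_slice (θ x : E) (s : ℝ) : Convex ℝ {t : ℝ | t • θ ∈ closedBall x s} :=
  (convex_closedBall x s).linear_preimage (LinearMap.toSpanSingleton ℝ E θ)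

end Geometry

theorem measure_closedBall_le_measure_ball {E : Type*} [NormedAddCommGroup E] [NormedSpace ℝ E]
    [MeasurableSpace E] [BorelSpace E] [FiniteDimensional ℝ E] [Nontrivial E]
    {μ ν : Measure E} [ν.IsAddHaarMeasure] (h : μ ≪ ν) (x : E) (r : ℝ) :
    μ (closedBall x r) ≤ μ (ball x r) := by
  rw [← ball_union_sphere]
  refine (measure_union_le _ _).trans ?_
  rw [h (Measure.addHaar_sphere ν x r), add_zero]

theorem isFiniteMeasureOnCompacts_of_Ioo {γ : Measure ℝ} (hγ : γ (Iic 0) = 0) {ε : ℝ}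
    (h0 : γ (Ioo 0 ε) < ∞) (hε : 0 < ε) (hIcc : ∀ a b, 0 < a → γ (Icc a b) < ∞) :
    IsFiniteMeasureOnCompacts γ := by
  refine ⟨fun K hK => ?_⟩
  obtain ⟨M, hM⟩ := hK.bddAbove
  have hsub : K ⊆ Iic 0 ∪ (Ioo 0 ε ∪ Icc ε M) := by
    intro t ht
    rcases le_or_gt t 0 with h | h
    · exact Or.inl h
    rcases lt_or_ge t ε with h' | h'
    · exact Or.inr (Or.inl ⟨h, h'⟩)
    · exact Or.inr (Or.inr ⟨h', hM ht⟩)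
  refine (measure_mono hsub).trans_lt ?_
  refine (measure_union_le _ _).trans_lt (ENNReal.add_lt_top.2 ⟨by simp [hγ], ?_⟩)
  exact (measure_union_le _ _).trans_lt (ENNReal.add_lt_top.2 ⟨h0, hIcc _ _ hε⟩)

section Radial

variable {E : Type*} [NormedAddCommGroup E] [InnerProductSpace ℝ E] [MeasurableSpace E]
  [BorelSpace E] [FiniteDimensional ℝ E] {μ : Measure E} {σ : Measure (sphere (0 : E) 1)}
  {γ : Measure ℝ} [SFinite γ]

theorem map_smul_prod_apply (hμ : (σ.prod γ).map (fun p => p.2 • (p.1 : E)) = μ)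
    {s : Set E} (hs : MeasurableSet s) :
    μ s = ∫⁻ θ, γ {t | t • (θ : E) ∈ s} ∂σ := by
  have hp : Measurable fun p : sphere (0 : E) 1 × ℝ => p.2 • (p.1 : E) := by fun_prop
  rw [← hμ, Measure.map_apply hp hs, Measure.prod_apply (hp hs)]
  rfl

/-- If shifting balls towards the origin controls their measure, then a measure which is radial with
a radial part finite on compact subsets of `(0, ∞)` has a radial part that is finite on all compact
sets. -/
theorem isFiniteMeasureOnCompacts_of_shift [IsFiniteMeasure σ]
    (hμ : (σ.prod γ).map (fun p => p.2 • (p.1 : E)) = μ) (hσ : σ ≠ 0)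
    (hγ : γ (Iic 0) = 0) (hIcc : ∀ a b, 0 < a → γ (Icc a b) < ∞) {C : ℝ≥0∞} (hC : C ≠ ∞)
    {x : E} (hx : x ≠ 0)
    (hshift : ∀ r : ℝ, 0 < r → r ≤ 1 →
      μ (ball (√(1 - r ^ 2) • x) (r * ‖x‖)) ≤ C * μ (ball x (r * ‖x‖))) :
    IsFiniteMeasureOnCompacts γ := by
  have hρ : 0 < ‖x‖ := norm_pos_iff.2 hx
  have hθ (θ : sphere (0 : E) 1) (t : ℝ) : ‖t • (θ : E)‖ = |t| := by simp [norm_smul]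
  have hfin : μ (ball x (4 / 5 * ‖x‖)) < ∞ := by
    rw [map_smul_prod_apply hμ measurableSet_ball]
    refine (lintegral_mono (g := fun _ => γ (Icc (‖x‖ / 5) (9 / 5 * ‖x‖))) fun θ => ?_).trans_lt ?_
    · refine measure_mono_ae ?_
      have : ∀ᵐ t ∂γ, t ∉ Iic (0 : ℝ) := measure_eq_zero_iff_ae_notMem.1 hγ
      filter_upwards [this] with t ht htx
      have ht : 0 < t := not_le.1 ht
      have htx : ‖t • (θ : E) - x‖ < 4 / 5 * ‖x‖ := mem_ball_iff_norm.1 htx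
      have h1 := abs_lt.1 ((abs_norm_sub_norm_le _ _).trans_lt htx)
      rw [hθ, abs_of_pos ht] at h1
      constructor <;> linarith [h1.1, h1.2]
    · rw [lintegral_const]
      exact ENNReal.mul_lt_top (hIcc _ _ (by positivity)) (measure_lt_top _ _)
  have h35 : √(1 - (4 / 5 : ℝ) ^ 2) = 3 / 5 := by
    rw [show (1 - (4 / 5 : ℝ) ^ 2) = (3 / 5) ^ 2 by norm_num]
    exact Real.sqrt_sq (by norm_num)
  have h := hshift (4 / 5) (by norm_num) (by norm_num)
  rw [h35] at h
  have hfin0 : μ (ball ((3 / 5 : ℝ) • x) (4 / 5 * ‖x‖)) < ∞ :=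
    h.trans_lt (ENNReal.mul_lt_top hC.lt_top hfin)
  refine isFiniteMeasureOnCompacts_of_Ioo hγ (ε := ‖x‖ / 5) ?_ (by positivity) hIcc
  have hle : γ (Ioo 0 (‖x‖ / 5)) * σ univ ≤ μ (ball ((3 / 5 : ℝ) • x) (4 / 5 * ‖x‖)) := by
    rw [map_smul_prod_apply hμ measurableSet_ball, ← lintegral_const]
    refine lintegral_mono fun θ => measure_mono fun t ht => ?_
    rw [mem_ofPred_eq, mem_ball_iff_norm]
    refine (norm_sub_le _ _).trans_lt ?_
    rw [hθ, abs_of_pos ht.1, norm_smul, Real.norm_of_nonneg (by norm_num)]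
    linarith [ht.2]
  exact ENNReal.lt_top_of_mul_ne_top_left (hle.trans_lt hfin0).ne
    (by simpa using hσ)

theorem setLIntegral_closedBall_le_uncenteredMaximalPos_mul [IsFiniteMeasureOnCompacts γ]
    (hμ : (σ.prod γ).map (fun p => p.2 • (p.1 : E)) = μ) (hγ : γ (Iic 0) = 0)
    {f : E → ℝ} {f₀ : ℝ → ℝ} (hprof : ∀ y : E, y ≠ 0 → f y = f₀ ‖y‖) (hf : AEMeasurable f μ)
    {x : E} (hx : x ≠ 0) {s r : ℝ} (hs : 0 < s) (hr : r = min (s / ‖x‖) 1) :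
    ∫⁻ y in closedBall x s, ENNReal.ofReal |f y| ∂μ ≤ uncenteredMaximalPos γ f₀ ‖x‖ *
      (μ (closedBall x s) + μ (closedBall (√(1 - r ^ 2) • x) (r * ‖x‖))) := by
  have hρ : 0 < ‖x‖ := norm_pos_iff.2 hx
  have hr0 : 0 < r := hr ▸ lt_min (div_pos hs hρ) one_pos
  have hr1 : r ≤ 1 := hr ▸ min_le_right _ _
  have hpos : ∀ᵐ t ∂γ, t ∉ Iic (0 : ℝ) := measure_eq_zero_iff_ae_notMem.1 hγ
  have hp : Measurable fun p : sphere (0 : E) 1 × ℝ => p.2 • (p.1 : E) := by fun_prop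
  set A := uncenteredMaximalPos γ f₀ ‖x‖
  set c := √(1 - r ^ 2)
  have hc1 : c ≤ 1 := Real.sqrt_le_one.2 (by nlinarith)
  have hcρ : c * ‖x‖ ≤ ‖x‖ := mul_le_of_le_one_left hρ.le hc1
  have hF : AEMeasurable ((closedBall x s).indicator fun y => ENNReal.ofReal |f y|)
      ((σ.prod γ).map (fun p => p.2 • (p.1 : E))) := by
    rw [hμ]
    exact (ENNReal.measurable_ofReal.comp_aemeasurable hf.abs).indicator measurableSet_closedBall
  have slice (θ : sphere (0 : E) 1) :
      ∫⁻ t, (closedBall x s).indicator (fun y => ENNReal.ofReal |f y|) (t • (θ : E)) ∂γ ≤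
        A * (γ {t | t • (θ : E) ∈ closedBall x s} +
          γ {t | t • (θ : E) ∈ closedBall (c • x) (r * ‖x‖)}) := by
    have hθ : ‖(θ : E)‖ = 1 := by simp
    set T := {t : ℝ | t • (θ : E) ∈ closedBall x s}
    have hind : ∫⁻ t, (closedBall x s).indicator (fun y => ENNReal.ofReal |f y|) (t • (θ : E)) ∂γ =
        ∫⁻ t in T, ENNReal.ofReal |f₀ t| ∂γ := by
      rw [← lintegral_indicator (isCompact_ray_slice hθ x s).measurableSet]
      refine lintegral_congr_ae ?_
      filter_upwards [hpos] with t ht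
      have ht : 0 < t := not_le.1 ht
      by_cases htT : t • (θ : E) ∈ closedBall x s
      · have hne : t • (θ : E) ≠ 0 := by
          rw [← norm_ne_zero_iff, norm_smul, hθ]; simpa using ht.ne'
        rw [indicator_of_mem htT, indicator_of_mem (show t ∈ T from htT), hprof _ hne, norm_smul,
          hθ, mul_one, Real.norm_of_nonneg ht.le]
      · rw [indicator_of_notMem htT, indicator_of_notMem (show t ∉ T from htT)]
    rw [hind]
    by_cases hex : ∃ t ∈ T, 0 < t
    · obtain ⟨t, htT, ht⟩ := hex
      obtain ⟨h1, h2⟩ := ray_segment_subset_shifted_closedBall hθ hx hr hs ht htT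
      have hconn : IsConnected (T ∪ Icc (c * ‖x‖) ‖x‖) :=
        ⟨⟨t, Or.inl htT⟩, (convex_ray_slice (θ : E) x s).isPreconnected.union (c * ‖x‖) h1
          ⟨le_rfl, hcρ⟩ isPreconnected_Icc⟩
      have hIcc := eq_Icc_of_connected_compact hconn
        ((isCompact_ray_slice hθ x s).union isCompact_Icc)
      have hmem : ‖x‖ ∈ T ∪ Icc (c * ‖x‖) ‖x‖ := Or.inr ⟨hcρ, le_rfl⟩
      calc ∫⁻ t in T, ENNReal.ofReal |f₀ t| ∂γ
          ≤ ∫⁻ t in T ∪ Icc (c * ‖x‖) ‖x‖, ENNReal.ofReal |f₀ t| ∂γ :=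
            lintegral_mono_set subset_union_left
        _ ≤ A * γ (T ∪ Icc (c * ‖x‖) ‖x‖) := by
            rw [hIcc] at hmem ⊢
            exact setLIntegral_Icc_le_uncenteredMaximalPos_mul hγ f₀ hρ hmem
        _ ≤ A * (γ T + γ (Icc (c * ‖x‖) ‖x‖)) := by gcongr; exact measure_union_le _ _
        _ ≤ _ := by gcongr; exact h2
    · have hT0 : γ T = 0 := measure_mono_null (fun t ht => not_lt.1 fun h => hex ⟨t, ht, h⟩) hγ
      rw [setLIntegral_measure_zero _ _ hT0]
      exact zero_le
  calc ∫⁻ y in closedBall x s, ENNReal.ofReal |f y| ∂μ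
      = ∫⁻ θ, ∫⁻ t, (closedBall x s).indicator (fun y => ENNReal.ofReal |f y|)
          (t • (θ : E)) ∂γ ∂σ := by
        rw [← lintegral_indicator measurableSet_closedBall, ← hμ,
          lintegral_map' hF hp.aemeasurable]
        exact lintegral_prod _ (hF.comp_measurable hp)
    _ ≤ ∫⁻ θ : sphere (0 : E) 1, A * (γ {t | t • (θ : E) ∈ closedBall x s} +
          γ {t | t • (θ : E) ∈ closedBall (c • x) (r * ‖x‖)}) ∂σ := lintegral_mono slice
    _ = _ := by
        have hm (y : E) (u : ℝ) :
            Measurable fun θ : sphere (0 : E) 1 => γ {t | t • (θ : E) ∈ closedBall y u} :=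
          measurable_measure_prodMk_left (hp measurableSet_closedBall)
        have hadd : Measurable fun θ : sphere (0 : E) 1 =>
            γ {t | t • (θ : E) ∈ closedBall x s} +
              γ {t | t • (θ : E) ∈ closedBall (c • x) (r * ‖x‖)} := (hm _ _).add (hm _ _)
        rw [lintegral_const_mul _ hadd, lintegral_add_left (hm _ _),
          ← map_smul_prod_apply hμ measurableSet_closedBall,
          ← map_smul_prod_apply hμ measurableSet_closedBall]

end Radial

end

/-- The pointwise bound (31) in the proof of the main theorem: under the ball-shifting hypothesis
with constant `C`, the centered maximal function of a radial function `f` with profile `f₀` is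
bounded by `(C+1)` times the one-dimensional uncentered maximal function of `f₀` with respect to
`dγ₀(t) = μ₀(t) t^{d−1} dt` on `(0,∞)`, evaluated at `‖x‖₂`. -/
theorem pointwise_bound_by_one_dim_maximal (d : ℕ) (hd : 1 ≤ d)
    (μ₀ : ℝ → ℝ) (hmeas : Measurable μ₀)
    (hnonneg : ∀ t ∈ Set.Ioi (0 : ℝ), 0 ≤ μ₀ t)
    (hne : ¬ (∀ᵐ t ∂(volume.restrict (Set.Ioi (0 : ℝ))), μ₀ t = 0))
    (hloc : LocallyIntegrableOn (fun t => μ₀ t * t ^ (d - 1)) (Set.Ioi (0 : ℝ)))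
    (μ : Measure (EuclideanSpace ℝ (Fin d)))
    (hμ : μ = volume.withDensity fun y => ENNReal.ofReal (μ₀ ‖y‖))
    (γ₀ : Measure ℝ)
    (hγ₀ : γ₀ = (volume.withDensity fun t => ENNReal.ofReal (μ₀ t * t ^ (d - 1))).restrict
      (Set.Ioi (0 : ℝ)))
    (C : ℝ) (hC : 0 < C)
    (hshift : ∀ x : EuclideanSpace ℝ (Fin d), ∀ r : ℝ, 0 < r → r ≤ 1 →
      μ (ball (Real.sqrt (1 - r ^ 2) • x) (r * ‖x‖)) ≤ ENNReal.ofReal C * μ (ball x (r * ‖x‖)))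
    (f : EuclideanSpace ℝ (Fin d) → ℝ) (f₀ : ℝ → ℝ)
    (hprof : ∀ x : EuclideanSpace ℝ (Fin d), x ≠ 0 → f x = f₀ ‖x‖)
    (hint : Integrable f μ)
    (x : EuclideanSpace ℝ (Fin d)) (hx : x ≠ 0) :
    centeredMaximal μ f x ≤ ENNReal.ofReal (C + 1) * uncenteredMaximalPos γ₀ f₀ ‖x‖ := by
  have : NeZero d := ⟨by omega⟩
  have : Nontrivial (EuclideanSpace ℝ (Fin d)) := ⟨⟨x, 0, hx⟩⟩
  have hρ : 0 < ‖x‖ := norm_pos_iff.2 hx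
  have hmap := map_smul_toSphere_prod (volume : Measure (EuclideanSpace ℝ (Fin d))) hmeas
  rw [finrank_euclideanSpace_fin, ← hγ₀, ← hμ] at hmap
  have hγ0 : γ₀ (Set.Iic 0) = 0 := by
    rw [hγ₀, Measure.restrict_apply measurableSet_Iic, Set.Iic_inter_Ioi, Set.Ioc_self,
      measure_empty]
  have hsf : SFinite γ₀ := by rw [hγ₀]; infer_instance
  have hIcc : ∀ a b, 0 < a → γ₀ (Set.Icc a b) < ⊤ := by
    intro a b ha
    have hsub : Set.Icc a b ⊆ Set.Ioi 0 := fun t ht => ha.trans_le ht.1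
    have hi := hloc.integrableOn_compact_subset hsub isCompact_Icc
    rw [hγ₀, Measure.restrict_apply measurableSet_Icc, Set.inter_eq_left.2 hsub,
      withDensity_apply _ measurableSet_Icc]
    exact hi.lintegral_lt_top
  have hfin : IsFiniteMeasureOnCompacts γ₀ :=
    isFiniteMeasureOnCompacts_of_shift hmap (Measure.toSphere_ne_zero _) hγ0 hIcc
      ENNReal.ofReal_ne_top hx (hshift x)
  have hac : μ ≪ volume := hμ ▸ withDensity_absolutelyContinuous _ _
  refine iSup_le fun s => iSup_le fun hs => iSup_le fun hB => ?_
  rcases eq_or_ne (μ (closedBall x s)) ⊤ with htop | htop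
  · simp [htop]
  rw [ENNReal.inv_mul_le_iff hB.ne' htop]
  have hr0 : 0 < min (s / ‖x‖) 1 := lt_min (div_pos hs hρ) one_pos
  have hrs : min (s / ‖x‖) 1 * ‖x‖ ≤ s := (le_div_iff₀ hρ).1 (min_le_left _ _)
  refine (setLIntegral_closedBall_le_uncenteredMaximalPos_mul hmap hγ0 hprof
    hint.aestronglyMeasurable.aemeasurable hx hs rfl).trans ?_
  have hball : μ (closedBall (√(1 - min (s / ‖x‖) 1 ^ 2) • x) (min (s / ‖x‖) 1 * ‖x‖)) ≤
      ENNReal.ofReal C * μ (closedBall x s) :=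
    calc _ ≤ _ := measure_closedBall_le_measure_ball hac _ _
      _ ≤ _ := hshift x _ hr0 (min_le_right _ _)
      _ ≤ _ := by
        gcongr
        exact (ball_subset_ball hrs).trans ball_subset_closedBall
  calc _ ≤ uncenteredMaximalPos γ₀ f₀ ‖x‖ *
        (μ (closedBall x s) + ENNReal.ofReal C * μ (closedBall x s)) := by gcongr
    _ = _ := by
      rw [ENNReal.ofReal_add hC.le zero_le_one, ENNReal.ofReal_one]
      ring
end

section
/- Fix α > 0 and let d be a dimension with d ≥ 2α, and let μ_α be the measure on ℝ^d with density dμ_α(y) = ‖y‖₂^{-α} dy. Then for every radial f ∈ L¹(ℝ^d, μ_α) and every λ > 0, μ_α({x : M_{μ_α} f(x) > λ}) ≤ (2(4·6^{α/2} + 1)/λ) · ‖f‖_{L¹(μ_α)}. -/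
open MeasureTheory Metric

/-- From a finite family of intervals one can extract a subfamily with the same union such that
no point lies in more than two of its members. -/
lemma exists_subfamily_overlap_le_two {ι : Type*} [DecidableEq ι] (a b : ι → ℝ) (s : Finset ι) :
    ∃ t ⊆ s, (⋃ i ∈ s, Set.Ioo (a i) (b i)) ⊆ (⋃ i ∈ t, Set.Ioo (a i) (b i)) ∧
      ∀ x, (t.filter (fun i => a i < x ∧ x < b i)).card ≤ 2 := by
  induction s using Finset.strongInduction with
  | H s ih =>
    by_cases h : ∀ x, (s.filter (fun i => a i < x ∧ x < b i)).card ≤ 2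
    · exact ⟨s, subset_rfl, subset_rfl, h⟩
    · push Not at h
      obtain ⟨x, hx⟩ := h
      set u := s.filter (fun i => a i < x ∧ x < b i) with hu
      have hne : u.Nonempty := Finset.card_pos.1 (by omega)
      obtain ⟨p, hp, hpmin⟩ := u.exists_min_image a hne
      obtain ⟨q, hq, hqmax⟩ := u.exists_max_image b hne
      obtain ⟨k, hk, hkpq⟩ : ∃ k ∈ u, k ∉ ({p, q} : Finset ι) := by
        by_contra! hcon
        have := Finset.card_le_card (show u ⊆ {p, q} from hcon)
        have := Finset.card_le_two (a := p) (b := q)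
        omega
      simp only [Finset.mem_insert, Finset.mem_singleton, not_or] at hkpq
      have hmem : ∀ {i}, i ∈ u → i ∈ s ∧ a i < x ∧ x < b i := fun hi => by
        simpa [hu] using hi
      obtain ⟨t, hts, hcov, hcard⟩ := ih (s.erase k) (Finset.erase_ssubset (hmem hk).1)
      refine ⟨t, hts.trans (Finset.erase_subset _ _), subset_trans ?_ hcov, hcard⟩
      intro y hy
      simp only [Set.mem_iUnion, Set.mem_Ioo, exists_prop, Finset.mem_erase] at hy ⊢
      obtain ⟨i, his, hy⟩ := hy
      by_cases hik : i = k
      · subst hik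
        rcases lt_or_ge y (b p) with hyp | hyp
        · exact ⟨p, ⟨Ne.symm hkpq.1, (hmem hp).1⟩, (hpmin i hk).trans_lt hy.1, hyp⟩
        · exact ⟨q, ⟨Ne.symm hkpq.2, (hmem hq).1⟩,
            (hmem hq).2.1.trans ((hmem hp).2.2.trans_le hyp), hy.2.trans_le (hqmax i hk)⟩
      · exact ⟨i, ⟨hik, his⟩, hy⟩

lemma mul_measure_finset_iUnion_Ioo_le {ι : Type*} (ν : Measure ℝ) {g : ℝ → ENNReal}
    (hg : Measurable g) (c : ENNReal) (a b : ι → ℝ)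
    (h : ∀ i, c * ν (Set.Ioo (a i) (b i)) ≤ ∫⁻ t in Set.Ioo (a i) (b i), g t ∂ν)
    (s : Finset ι) :
    c * ν (⋃ i ∈ s, Set.Ioo (a i) (b i)) ≤ 2 * ∫⁻ t, g t ∂ν := by
  classical
  obtain ⟨t, -, hcov, hcard⟩ := exists_subfamily_overlap_le_two a b s
  calc c * ν (⋃ i ∈ s, Set.Ioo (a i) (b i))
      ≤ c * ∑ i ∈ t, ν (Set.Ioo (a i) (b i)) := by
        gcongr
        exact (measure_mono hcov).trans (measure_biUnion_finset_le _ _)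
    _ ≤ ∑ i ∈ t, ∫⁻ y in Set.Ioo (a i) (b i), g y ∂ν := by
        rw [Finset.mul_sum]
        exact Finset.sum_le_sum fun i _ => h i
    _ = ∫⁻ y, ∑ i ∈ t, (Set.Ioo (a i) (b i)).indicator g y ∂ν := by
        rw [lintegral_finsetSum _ fun i _ => hg.indicator measurableSet_Ioo]
        simp_rw [lintegral_indicator measurableSet_Ioo]
    _ ≤ ∫⁻ y, 2 * g y ∂ν := by
        refine lintegral_mono fun y => ?_
        simp only [Set.indicator_apply, Set.mem_Ioo]
        rw [← Finset.sum_filter, Finset.sum_const, nsmul_eq_mul]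
        gcongr
        exact_mod_cast hcard y
    _ = _ := lintegral_const_mul _ hg

/-- The uncentered maximal inequality on the line, with constant `2`. -/
lemma mul_measure_le_of_forall_Icc (ν : Measure ℝ) [IsLocallyFiniteMeasure ν]
    {g : ℝ → ENNReal} (hg : Measurable g) {c : ENNReal} (hc : c ≠ 0) (hc' : c ≠ ⊤) (A : Set ℝ)
    (h : ∀ x ∈ A, ∃ a b, a ≤ x ∧ x ≤ b ∧
      c * ν (Set.Icc a b) < ∫⁻ t in Set.Icc a b, g t ∂ν) :
    c * ν A ≤ 2 * ∫⁻ t, g t ∂ν := by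
  have h' : ∀ x : A, ∃ a b, a < (x : ℝ) ∧ (x : ℝ) < b ∧
      c * ν (Set.Ioo a b) ≤ ∫⁻ t in Set.Ioo a b, g t ∂ν := by
    rintro ⟨x, hx⟩
    obtain ⟨a, b, hax, hxb, hlt⟩ := h x hx
    have hlt' : ν (Set.Icc a b) < (∫⁻ t in Set.Icc a b, g t ∂ν) / c := by
      rw [ENNReal.lt_div_iff_mul_lt (Or.inl hc) (Or.inl hc'), mul_comm]
      exact hlt
    obtain ⟨U, hU, hUo, hUlt⟩ := Set.exists_isOpen_lt_of_lt _ _ hlt'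
    obtain ⟨ε, hε, hεU⟩ := isCompact_Icc.exists_thickening_subset_open hUo hU
    have hsub : Set.Ioo (a - ε) (b + ε) ⊆ U := by
      refine subset_trans (fun y hy => ?_) hεU
      rw [mem_thickening_iff]
      rcases lt_or_ge y a with hya | hya
      · exact ⟨a, ⟨le_rfl, hax.trans hxb⟩, by
          rw [Real.dist_eq, abs_lt]; constructor <;> linarith [hy.1]⟩
      · rcases lt_or_ge b y with hyb | hyb
        · exact ⟨b, ⟨hax.trans hxb, le_rfl⟩, by
            rw [Real.dist_eq, abs_lt]; constructor <;> linarith [hy.2]⟩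
        · exact ⟨y, ⟨hya, hyb⟩, by simpa using hε⟩
    refine ⟨a - ε, b + ε, by dsimp; linarith, by dsimp; linarith, ?_⟩
    have h1 : ν (Set.Ioo (a - ε) (b + ε)) ≤ (∫⁻ t in Set.Icc a b, g t ∂ν) / c :=
      (measure_mono hsub).trans hUlt.le
    rw [ENNReal.le_div_iff_mul_le (Or.inl hc) (Or.inl hc'), mul_comm] at h1
    refine h1.trans (lintegral_mono_set fun y hy => ⟨?_, ?_⟩) <;> linarith [hy.1, hy.2]
  choose a b ha hb hab using h'
  obtain ⟨T, hT, hTU⟩ := TopologicalSpace.isOpen_iUnion_countable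
    (fun x : A => Set.Ioo (a x) (b x)) fun _ => isOpen_Ioo
  have hA : A ⊆ ⋃ i ∈ T, Set.Ioo (a i) (b i) := by
    rw [hTU]
    exact fun x hx => Set.mem_iUnion.2 ⟨⟨x, hx⟩, ha ⟨x, hx⟩, hb ⟨x, hx⟩⟩
  have hsup : c * ν (⋃ i ∈ T, Set.Ioo (a i) (b i)) ≤ 2 * ∫⁻ t, g t ∂ν := by
    have : Countable T := hT
    rw [Set.biUnion_eq_iUnion, Set.iUnion_eq_iUnion_finset,
      Directed.measure_iUnion, ENNReal.mul_iSup]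
    · exact iSup_le fun s =>
        mul_measure_finset_iUnion_Ioo_le ν hg c (fun i : T => a i) (fun i : T => b i)
          (fun i => hab i) s
    · exact directed_of_isDirected_le fun s t hst =>
        Set.biUnion_subset_biUnion_left hst
  exact le_trans (by gcongr) hsup

/-- The measure on `(0, ∞)` with density `t ^ p`, seen as a measure on the real line. -/
noncomputable def radialMeasure (p : ℝ) : Measure ℝ :=
  (volume.restrict (Set.Ioi 0)).withDensity fun t => ENNReal.ofReal (t ^ p)

instance radialMeasure.instSFinite (p : ℝ) : SFinite (radialMeasure p) := by
  unfold radialMeasure; infer_instance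

lemma ae_radialMeasure_pos (p : ℝ) : ∀ᵐ t ∂radialMeasure p, 0 < t :=
  (withDensity_absolutelyContinuous _ _).ae_le (ae_restrict_mem measurableSet_Ioi)

lemma radialMeasure_Icc {p a b : ℝ} (hp : -1 < p) (ha : 0 ≤ a) (hab : a ≤ b) :
    radialMeasure p (Set.Icc a b) =
      ENNReal.ofReal ((b ^ (p + 1) - a ^ (p + 1)) / (p + 1)) := by
  rw [radialMeasure, withDensity_apply _ measurableSet_Icc,
    Measure.restrict_restrict measurableSet_Icc]
  have hset : (Set.Icc a b ∩ Set.Ioi 0 : Set ℝ) =ᵐ[volume] Set.Ioc a b := by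
    refine Filter.EventuallyEq.trans ?_ Ioc_ae_eq_Icc.symm
    have : ∀ᵐ x : ℝ ∂volume, x ≠ 0 := by simp [ae_iff]
    filter_upwards [this] with x hx
    refine propext ⟨fun h => h.1, fun h => ⟨h, ?_⟩⟩
    exact lt_of_le_of_ne (ha.trans h.1) (Ne.symm hx)
  rw [Measure.restrict_congr_set hset, ← integral_rpow (Or.inl hp),
    intervalIntegral.integral_of_le hab,
    ofReal_integral_eq_lintegral_ofReal (intervalIntegral.intervalIntegrable_rpow' hp).1]
  filter_upwards [ae_restrict_mem measurableSet_Ioc] with t ht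
  exact Real.rpow_nonneg (ha.trans ht.1.le) _

lemma isLocallyFiniteMeasure_radialMeasure {p : ℝ} (hp : -1 < p) :
    IsLocallyFiniteMeasure (radialMeasure p) := by
  refine ⟨fun x => ⟨Set.Iio (|x| + 1), Iio_mem_nhds (by linarith [le_abs_self x]), ?_⟩⟩
  have : radialMeasure p (Set.Iio (|x| + 1)) ≤ radialMeasure p (Set.Icc 0 (|x| + 1)) := by
    refine measure_mono_ae ?_
    filter_upwards [ae_radialMeasure_pos p] with t ht h
    exact ⟨ht.le, le_of_lt h⟩
  refine this.trans_lt ?_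
  rw [radialMeasure_Icc hp le_rfl (by positivity)]
  exact ENNReal.ofReal_lt_top

lemma radialMeasure_Icc_le {α : ℝ} (hα : 0 < α) {n : ℝ} (hn : 2 * α ≤ n) {s R : ℝ}
    (hs : 0 ≤ s) (hsR : s ≤ R) (hR : 0 < R) :
    radialMeasure (n - 1 - α) (Set.Icc s R) ≤
      ENNReal.ofReal (2 * R ^ (-α)) * radialMeasure (n - 1) (Set.Icc s R) := by
  rw [radialMeasure_Icc (by linarith) hs hsR, radialMeasure_Icc (by linarith) hs hsR,
    ← ENNReal.ofReal_mul (by positivity)]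
  refine ENNReal.ofReal_le_ofReal ?_
  rw [show n - 1 - α + 1 = n - α by ring, show n - 1 + 1 = n by ring]
  have hRR : R ^ (n - α) = R ^ (-α) * R ^ n := by
    rw [← Real.rpow_add hR]; ring_nf
  have hss : R ^ (-α) * s ^ n ≤ s ^ (n - α) := by
    rcases hs.eq_or_lt with rfl | hs
    · rw [Real.zero_rpow (by linarith), Real.zero_rpow (by linarith), mul_zero]
    · rw [show n - α = -α + n by ring, Real.rpow_add hs]
      gcongr ?_ * _
      exact Real.rpow_le_rpow_of_nonpos hs hsR (by linarith)
  have hnn : 0 ≤ R ^ n - s ^ n := sub_nonneg.2 (Real.rpow_le_rpow hs hsR (by linarith))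
  have hD : 0 ≤ R ^ (-α) * (R ^ n - s ^ n) := by positivity
  calc (R ^ (n - α) - s ^ (n - α)) / (n - α)
      ≤ (R ^ (-α) * (R ^ n - s ^ n)) / (n - α) := by
        gcongr
        · linarith
        · rw [hRR, mul_sub]; linarith
    _ ≤ (R ^ (-α) * (R ^ n - s ^ n)) / (n / 2) := by
        gcongr <;> linarith
    _ = _ := by field_simp

lemma muAlpha_zero (d : ℕ) : muAlpha d 0 = volume := by
  simp [muAlpha]

lemma lintegral_muAlpha {d : ℕ} (hd : 0 < d) (α : ℝ) {G : EuclideanSpace ℝ (Fin d) → ENNReal}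
    (hG : Measurable G) :
    ∫⁻ x, G x ∂muAlpha d α =
      ∫⁻ ω, ∫⁻ t, G (t • (ω : EuclideanSpace ℝ (Fin d))) ∂radialMeasure (d - 1 - α)
        ∂(volume : Measure (EuclideanSpace ℝ (Fin d))).toSphere := by
  have : Nonempty (Fin d) := ⟨⟨0, hd⟩⟩
  have hw : Measurable fun x : EuclideanSpace ℝ (Fin d) => ENNReal.ofReal (‖x‖ ^ (-α)) := by
    fun_prop
  have hH : Measurable fun x : EuclideanSpace ℝ (Fin d) =>
      ENNReal.ofReal (‖x‖ ^ (-α)) * G x := hw.mul hG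
  have hmp :=
    (volume : Measure (EuclideanSpace ℝ (Fin d))).measurePreserving_homeomorphUnitSphereProd
  have hpolar : ∫⁻ x, G x ∂muAlpha d α =
      ∫⁻ z, (fun x : EuclideanSpace ℝ (Fin d) => ENNReal.ofReal (‖x‖ ^ (-α)) * G x)
        ((homeomorphUnitSphereProd (EuclideanSpace ℝ (Fin d))).symm z)
        ∂((volume : Measure (EuclideanSpace ℝ (Fin d))).toSphere.prod
          (Measure.volumeIoiPow (Module.finrank ℝ (EuclideanSpace ℝ (Fin d)) - 1))) := by
    rw [muAlpha, lintegral_withDensity_eq_lintegral_mul _ hw hG,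
      ← restrict_compl_singleton (μ := volume) (0 : EuclideanSpace ℝ (Fin d)),
      ← lintegral_subtype_comap (measurableSet_singleton _).compl, restrict_compl_singleton]
    exact ((hmp.symm (homeomorphUnitSphereProd _).toMeasurableEquiv).lintegral_comp
      (hH.comp measurable_subtype_coe)).symm
  rw [hpolar]
  rw [lintegral_prod _ ?_]
  swap
  · exact (hH.comp (measurable_subtype_coe.comp
      (homeomorphUnitSphereProd _).symm.measurable)).aemeasurable
  refine lintegral_congr fun ω => ?_
  have hGω : Measurable fun t : ℝ => G (t • (ω : EuclideanSpace ℝ (Fin d))) := by fun_prop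
  rw [Measure.volumeIoiPow, lintegral_withDensity_eq_lintegral_mul _ (by fun_prop),
    radialMeasure, lintegral_withDensity_eq_lintegral_mul _ (by fun_prop) hGω,
    ← lintegral_subtype_comap measurableSet_Ioi]
  · refine lintegral_congr fun t => ?_
    have ht : 0 < (t : ℝ) := t.2
    have hω : ‖(ω : EuclideanSpace ℝ (Fin d))‖ = 1 := by simp
    have : ((d - 1 : ℕ) : ℝ) = d - 1 := by
      rw [Nat.cast_sub hd]; simp
    simp only [Pi.mul_apply, finrank_euclideanSpace, Fintype.card_fin]
    simp [norm_smul, hω, abs_of_pos ht]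
    rw [← mul_assoc, ← ENNReal.ofReal_mul (by positivity), ← Real.rpow_natCast, this,
      ← Real.rpow_add ht]
    rfl
  · fun_prop

lemma measurable_radialMeasure_ray {d : ℕ} (p : ℝ) {S : Set (EuclideanSpace ℝ (Fin d))}
    (hS : MeasurableSet S) :
    Measurable fun ω : sphere (0 : EuclideanSpace ℝ (Fin d)) 1 =>
      radialMeasure p ((fun t : ℝ => t • (ω : EuclideanSpace ℝ (Fin d))) ⁻¹' S) := by
  have hm : Measurable fun z : sphere (0 : EuclideanSpace ℝ (Fin d)) 1 × ℝ =>
      z.2 • (z.1 : EuclideanSpace ℝ (Fin d)) := by fun_prop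
  exact measurable_measure_prodMk_left (hm hS)

lemma muAlpha_apply {d : ℕ} (hd : 0 < d) (α : ℝ) {S : Set (EuclideanSpace ℝ (Fin d))}
    (hS : MeasurableSet S) :
    muAlpha d α S =
      ∫⁻ ω, radialMeasure (d - 1 - α)
        ((fun t : ℝ => t • (ω : EuclideanSpace ℝ (Fin d))) ⁻¹' S)
        ∂(volume : Measure (EuclideanSpace ℝ (Fin d))).toSphere := by
  rw [← lintegral_indicator_one hS, lintegral_muAlpha hd α (measurable_one.indicator hS)]
  refine lintegral_congr fun ω => ?_
  have hm : Measurable fun t : ℝ => t • (ω : EuclideanSpace ℝ (Fin d)) := by fun_prop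
  rw [← lintegral_indicator_one (hm hS)]
  rfl


/-- The profile of a radial function can be chosen measurable, up to null sets. -/
lemma exists_measurable_profile {d : ℕ} (hd : 0 < d) {α : ℝ}
    {f : EuclideanSpace ℝ (Fin d) → ℝ} (hrad : IsRadial f)
    (hf : AEStronglyMeasurable f (muAlpha d α)) :
    ∃ F : ℝ → ENNReal, Measurable F ∧
      ∀ᵐ x ∂muAlpha d α, ENNReal.ofReal |f x| = F ‖x‖ := by
  have : Nonempty (Fin d) := ⟨⟨0, hd⟩⟩
  obtain ⟨f₀, hf₀⟩ := hrad
  set g := hf.mk f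
  have hg : Measurable g := hf.stronglyMeasurable_mk.measurable
  obtain ⟨N, hN, hNm, hN0⟩ := exists_measurable_superset_of_null (ae_iff.1 hf.ae_eq_mk)
  have hslice : ∀ᵐ (ω : sphere (0 : EuclideanSpace ℝ (Fin d)) 1)
      ∂(volume : Measure (EuclideanSpace ℝ (Fin d))).toSphere,
      ∀ᵐ t ∂radialMeasure (d - 1 - α), g (t • (ω : EuclideanSpace ℝ (Fin d))) = f₀ t := by
    rw [muAlpha_apply hd α hNm, lintegral_eq_zero_iff (measurable_radialMeasure_ray _ hNm)] at hN0
    filter_upwards [hN0] with ω hω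
    have hω' : ∀ᵐ t ∂radialMeasure (d - 1 - α), t • (ω : EuclideanSpace ℝ (Fin d)) ∉ N :=
      measure_eq_zero_iff_ae_notMem.1 hω
    filter_upwards [hω', ae_radialMeasure_pos _] with t htN htpos
    have hfg : f (t • (ω : EuclideanSpace ℝ (Fin d))) = g (t • (ω : EuclideanSpace ℝ (Fin d))) := by
      by_contra hne
      exact htN (hN hne)
    have hωn : ‖(ω : EuclideanSpace ℝ (Fin d))‖ = 1 := by simp
    have hnorm : ‖t • (ω : EuclideanSpace ℝ (Fin d))‖ = t := by
      rw [norm_smul, hωn, mul_one, Real.norm_of_nonneg htpos.le]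
    rw [← hfg, hf₀ _ (by rw [← norm_pos_iff, hnorm]; exact htpos), hnorm]
  have : NeZero (volume : Measure (EuclideanSpace ℝ (Fin d))).toSphere :=
    ⟨Measure.toSphere_ne_zero _⟩
  obtain ⟨ω₀, hω₀⟩ := hslice.exists
  refine ⟨fun t => ENNReal.ofReal |g (t • (ω₀ : EuclideanSpace ℝ (Fin d)))|, by fun_prop, ?_⟩
  have hP : MeasurableSet {x : EuclideanSpace ℝ (Fin d) |
      g x ≠ g (‖x‖ • (ω₀ : EuclideanSpace ℝ (Fin d)))} :=
    (measurableSet_eq_fun hg (by fun_prop)).compl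
  have hP0 : muAlpha d α {x : EuclideanSpace ℝ (Fin d) |
      g x ≠ g (‖x‖ • (ω₀ : EuclideanSpace ℝ (Fin d)))} = 0 := by
    rw [muAlpha_apply hd α hP]
    refine (lintegral_congr_ae ?_).trans lintegral_zero
    filter_upwards [hslice] with ω hω
    refine measure_eq_zero_iff_ae_notMem.2 ?_
    filter_upwards [hω, hω₀, ae_radialMeasure_pos _] with t h1 h2 htpos
    have hωn : ‖(ω : EuclideanSpace ℝ (Fin d))‖ = 1 := by simp
    have hnorm : ‖t • (ω : EuclideanSpace ℝ (Fin d))‖ = t := by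
      rw [norm_smul, hωn, mul_one, Real.norm_of_nonneg htpos.le]
    simp only [Set.mem_preimage, Set.mem_ofPred_eq, not_not, hnorm, h1, h2]
  filter_upwards [hf.ae_eq_mk, (ae_iff.2 hP0 : ∀ᵐ x ∂muAlpha d α,
    g x = g (‖x‖ • (ω₀ : EuclideanSpace ℝ (Fin d))))] with x hx1 hx2
  rw [hx1, ← hx2]


/-- If the ray in direction `ω` meets the ball `B(x, r)`, then it does so at `s ω`, where
`s² = ‖x‖² - min(r, ‖x‖)²`, and the segment from `s ω` to `‖x‖ ω` lies in the ball of radius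
`min(r, ‖x‖)` centered at `(s / ‖x‖) x`. -/
lemma ray_closedBall {E : Type*} [NormedAddCommGroup E] [InnerProductSpace ℝ E] {x ω : E}
    {r s t : ℝ} (hx : x ≠ 0) (hω : ‖ω‖ = 1) (hr : 0 < r) (hs : 0 ≤ s)
    (hs2 : s ^ 2 = ‖x‖ ^ 2 - min r ‖x‖ ^ 2) (ht : 0 < t) (hmem : t • ω ∈ closedBall x r) :
    s • ω ∈ closedBall x r ∧
      ∀ τ ∈ Set.Icc s ‖x‖, τ • ω ∈ closedBall ((s / ‖x‖) • x) (min r ‖x‖) := by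
  have hR : 0 < ‖x‖ := norm_pos_iff.2 hx
  have hdist : ∀ u v ρ : ℝ, 0 ≤ ρ → (u • ω ∈ closedBall (v • x) ρ ↔
      u ^ 2 - 2 * u * v * inner ℝ ω x + v ^ 2 * ‖x‖ ^ 2 ≤ ρ ^ 2) := by
    intro u v ρ hρ
    have : dist (u • ω) (v • x) ^ 2 = u ^ 2 - 2 * u * v * inner ℝ ω x + v ^ 2 * ‖x‖ ^ 2 := by
      rw [dist_eq_norm, norm_sub_sq_real, norm_smul, norm_smul, hω, real_inner_smul_left,
        real_inner_smul_right, mul_pow, mul_pow, Real.norm_eq_abs, Real.norm_eq_abs, sq_abs, sq_abs]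
      ring
    rw [mem_closedBall, ← this, sq_le_sq₀ dist_nonneg hρ]
  have hdist1 : ∀ u : ℝ, (u • ω ∈ closedBall x r ↔
      u ^ 2 - 2 * u * inner ℝ ω x + ‖x‖ ^ 2 ≤ r ^ 2) := by
    intro u
    have := hdist u 1 r hr.le
    simpa using this
  rw [hdist1] at hmem
  have hmin0 : 0 ≤ min r ‖x‖ := le_min hr.le hR.le
  have hmin1 : min r ‖x‖ ≤ r := min_le_left _ _
  have hinner : s = 0 ∨ s ≤ inner ℝ ω x := by
    rcases le_total r ‖x‖ with h | h
    · right
      rw [min_eq_left h] at hs2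
      by_contra! hlt
      nlinarith [sq_nonneg (t - s), mul_lt_mul_of_pos_left hlt ht]
    · left
      rw [min_eq_right h] at hs2
      nlinarith
  have hss : s ^ 2 ≤ s * inner ℝ ω x := by
    rcases hinner with h | h
    · simp [h]
    · nlinarith
  refine ⟨?_, fun τ hτ => ?_⟩
  · rw [hdist1]
    nlinarith
  · rw [hdist _ _ _ hmin0]
    have hsR : s ≤ ‖x‖ := hτ.1.trans hτ.2
    have h1 : s ^ 2 / ‖x‖ ≤ s / ‖x‖ * inner ℝ ω x := by
      rw [div_mul_eq_mul_div]; gcongr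
    have h2 : (s / ‖x‖) ^ 2 * ‖x‖ ^ 2 = s ^ 2 := by field_simp
    have h3 : s ^ 2 / ‖x‖ ≤ s := by
      rw [div_le_iff₀ hR]; nlinarith
    have h4 : s ^ 2 / ‖x‖ * ‖x‖ = s ^ 2 := by field_simp
    have h5 : τ * (s ^ 2 / ‖x‖) ≤ τ * (s / ‖x‖ * inner ℝ ω x) :=
      mul_le_mul_of_nonneg_left h1 (hs.trans hτ.1)
    have h6 : 0 ≤ (‖x‖ - τ) * (τ + ‖x‖ - 2 * (s ^ 2 / ‖x‖)) :=
      mul_nonneg (by linarith [hτ.2]) (by linarith [hτ.1])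
    rw [h2]
    nlinarith

/-- On `B(x, r)` with `r ≤ ‖x‖`, the density of `muAlpha` is at least `(2 ‖x‖) ^ (-α)`. -/
lemma volume_closedBall_le_muAlpha {d : ℕ} (hd : 0 < d) {α : ℝ} (hα : 0 < α)
    {x : EuclideanSpace ℝ (Fin d)} {r : ℝ} (hx : x ≠ 0) (hr : r ≤ ‖x‖) :
    volume (closedBall x r) ≤
      ENNReal.ofReal ((2 * ‖x‖) ^ α) * muAlpha d α (closedBall x r) := by
  have : Nonempty (Fin d) := ⟨⟨0, hd⟩⟩
  have hR : 0 < ‖x‖ := norm_pos_iff.2 hx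
  rw [muAlpha, withDensity_apply _ measurableSet_closedBall,
    ← lintegral_const_mul _ (by fun_prop), ← setLIntegral_one]
  refine lintegral_mono_ae ?_
  have h0 : ∀ᵐ y : EuclideanSpace ℝ (Fin d) ∂volume, y ≠ 0 := by simp [ae_iff]
  filter_upwards [ae_restrict_mem measurableSet_closedBall, ae_restrict_of_ae h0] with y hy hy0
  have hy0 : 0 < ‖y‖ := norm_pos_iff.2 hy0
  rw [← ENNReal.ofReal_mul (by positivity), ← ENNReal.ofReal_one]
  refine ENNReal.ofReal_le_ofReal ?_
  rw [Real.rpow_neg hy0.le, ← div_eq_mul_inv, le_div_iff₀ (by positivity), one_mul]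
  refine Real.rpow_le_rpow hy0.le ?_ hα.le
  have := norm_le_norm_add_norm_sub' y x
  rw [mem_closedBall, dist_eq_norm] at hy
  linarith

/-- One-dimensional form of the pointwise domination, along the ray in direction `ω`. -/
lemma lintegral_ray_le {E : Type*} [NormedAddCommGroup E] [InnerProductSpace ℝ E] {x ω : E}
    {α n r s : ℝ} (hα : 0 < α) (hn : 2 * α ≤ n) {F : ℝ → ENNReal} {c : ENNReal}
    (hx : x ≠ 0) (hω : ‖ω‖ = 1) (hr : 0 < r) (hs : 0 ≤ s)
    (hs2 : s ^ 2 = ‖x‖ ^ 2 - min r ‖x‖ ^ 2)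
    (h : ∀ a b, a ≤ ‖x‖ → ‖x‖ ≤ b → ∫⁻ t in Set.Icc a b, F t ∂radialMeasure (n - 1 - α) ≤
      c * radialMeasure (n - 1 - α) (Set.Icc a b)) :
    ∫⁻ t, (closedBall x r).indicator (fun y => F ‖y‖) (t • ω) ∂radialMeasure (n - 1 - α) ≤
      c * (radialMeasure (n - 1 - α) ((fun t : ℝ => t • ω) ⁻¹' closedBall x r) +
        ENNReal.ofReal (2 * ‖x‖ ^ (-α)) * radialMeasure (n - 1)
          ((fun t : ℝ => t • ω) ⁻¹' closedBall ((s / ‖x‖) • x) (min r ‖x‖))) := by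
  have hR : 0 < ‖x‖ := norm_pos_iff.2 hx
  have hsR : s ≤ ‖x‖ := by
    rw [← sq_le_sq₀ hs hR.le, hs2]
    nlinarith [sq_nonneg (min r ‖x‖)]
  set m := radialMeasure (n - 1 - α) with hm
  have hcont : Continuous fun t : ℝ => t • ω := by fun_prop
  by_cases hex : ∃ t : ℝ, 0 < t ∧ t • ω ∈ closedBall x r
  · obtain ⟨t₀, ht₀, ht₀B⟩ := hex
    obtain ⟨hsB, hseg⟩ := ray_closedBall hx hω hr hs hs2 ht₀ ht₀B
    set I : Set ℝ := (fun t : ℝ => t • ω) ⁻¹' closedBall x r ∩ Set.Ici 0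
    have hsI : s ∈ I := ⟨hsB, hs⟩
    have hIclosed : IsClosed I := (isClosed_closedBall.preimage hcont).inter isClosed_Ici
    have hIconv : Convex ℝ I :=
      ((convex_closedBall x r).is_linear_preimage
        (f := fun t : ℝ => t • ω) ⟨fun a b => add_smul a b ω, fun a b => by
          simp [mul_smul]⟩).inter (convex_Ici 0)
    have hIbdd : I ⊆ Set.Icc 0 (‖x‖ + r) := by
      rintro t ⟨ht, ht0⟩
      refine ⟨ht0, ?_⟩
      have h1 : ‖t • ω‖ ≤ ‖x‖ + r := norm_le_of_mem_closedBall ht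
      rwa [norm_smul, hω, mul_one, Real.norm_of_nonneg ht0] at h1
    have hIcpt : IsCompact I := isCompact_Icc.of_isClosed_subset hIclosed hIbdd
    have hJ : IsPreconnected (I ∪ Set.Icc s ‖x‖) :=
      IsPreconnected.union s hsI ⟨le_rfl, hsR⟩ hIconv.isPreconnected isPreconnected_Icc
    have hJeq := eq_Icc_of_connected_compact ⟨⟨s, Or.inl hsI⟩, hJ⟩ (hIcpt.union isCompact_Icc)
    set a := sInf (I ∪ Set.Icc s ‖x‖)
    set b := sSup (I ∪ Set.Icc s ‖x‖)
    have hRJ : ‖x‖ ∈ Set.Icc a b := by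
      rw [← hJeq]; exact Or.inr ⟨hsR, le_rfl⟩
    calc ∫⁻ t, (closedBall x r).indicator (fun y => F ‖y‖) (t • ω) ∂m
        ≤ ∫⁻ t, (Set.Icc a b).indicator F t ∂m := by
          refine lintegral_mono_ae ?_
          filter_upwards [ae_radialMeasure_pos _] with t ht
          by_cases htB : t • ω ∈ closedBall x r
          swap
          · rw [Set.indicator_of_notMem htB]
            exact zero_le
          have : t ∈ Set.Icc a b := by
            rw [← hJeq]; exact Or.inl ⟨htB, ht.le⟩
          rw [Set.indicator_of_mem htB, Set.indicator_of_mem this, norm_smul, hω, mul_one,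
            Real.norm_of_nonneg ht.le]
      _ = ∫⁻ t in Set.Icc a b, F t ∂m := lintegral_indicator measurableSet_Icc _
      _ ≤ c * m (Set.Icc a b) := h a b hRJ.1 hRJ.2
      _ ≤ c * (m I + m (Set.Icc s ‖x‖)) := by
          rw [← hJeq]; gcongr; exact measure_union_le _ _
      _ ≤ _ := by
          gcongr
          · exact Set.inter_subset_left
          · exact (radialMeasure_Icc_le hα hn hs hsR hR).trans (by gcongr; exact hseg)
  · push Not at hex
    refine le_of_eq_of_le ((lintegral_congr_ae ?_).trans lintegral_zero) zero_le
    filter_upwards [ae_radialMeasure_pos _] with t ht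
    exact Set.indicator_of_notMem (hex t ht) _

/-- Comparison of the constants arising from the two density bounds. -/
lemma two_mul_rpow_mul_rpow_le {R α : ℝ} (hR : 0 < R) (hα : 0 < α) :
    2 * R ^ (-α) * (2 * R) ^ α ≤ 4 * (6 : ℝ) ^ (α / 2) := by
  have h1 : R ^ (-α) * R ^ α = 1 := by
    rw [← Real.rpow_add hR]; simp
  have h2 : (2 : ℝ) ^ α = 4 ^ (α / 2) := by
    rw [show (4 : ℝ) = 2 ^ (2 : ℝ) by norm_num, ← Real.rpow_mul (by norm_num)]
    ring_nf
  have h3 : (4 : ℝ) ^ (α / 2) ≤ 6 ^ (α / 2) :=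
    Real.rpow_le_rpow (by norm_num) (by norm_num) (by positivity)
  have h4 : (0 : ℝ) ≤ 6 ^ (α / 2) := by positivity
  rw [Real.mul_rpow (by norm_num) hR.le]
  calc 2 * R ^ (-α) * (2 ^ α * R ^ α)
      = 2 * 2 ^ α * (R ^ (-α) * R ^ α) := by ring
    _ ≤ _ := by rw [h1, h2]; linarith

/-- Pointwise domination of averages of a radial function by one-dimensional averages. -/
lemma setLIntegral_closedBall_le {d : ℕ} (hd0 : 0 < d) {α : ℝ} (hα : 0 < α) (hd : 2 * α ≤ d)
    {F : ℝ → ENNReal} (hF : Measurable F) {c : ENNReal} {x : EuclideanSpace ℝ (Fin d)}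
    (hx : x ≠ 0) {r : ℝ} (hr : 0 < r)
    (h : ∀ a b, a ≤ ‖x‖ → ‖x‖ ≤ b → ∫⁻ t in Set.Icc a b, F t ∂radialMeasure (d - 1 - α) ≤
      c * radialMeasure (d - 1 - α) (Set.Icc a b)) :
    ∫⁻ y in closedBall x r, F ‖y‖ ∂muAlpha d α ≤
      c * (ENNReal.ofReal (4 * (6 : ℝ) ^ (α / 2) + 1) * muAlpha d α (closedBall x r)) := by
  have hR : 0 < ‖x‖ := norm_pos_iff.2 hx
  obtain ⟨s, hs, hs2⟩ : ∃ s : ℝ, 0 ≤ s ∧ s ^ 2 = ‖x‖ ^ 2 - min r ‖x‖ ^ 2 := by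
    refine ⟨√(‖x‖ ^ 2 - min r ‖x‖ ^ 2), Real.sqrt_nonneg _, Real.sq_sqrt ?_⟩
    rw [sub_nonneg]
    exact pow_le_pow_left₀ (le_min hr.le hR.le) (min_le_right _ _) 2
  have hBm : MeasurableSet (closedBall x r) := measurableSet_closedBall
  set B' := closedBall ((s / ‖x‖) • x) (min r ‖x‖) with hB'
  have hB'm : MeasurableSet B' := measurableSet_closedBall
  set K := ENNReal.ofReal (2 * ‖x‖ ^ (-α)) with hK
  have hvol : volume B' ≤
      ENNReal.ofReal ((2 * ‖x‖) ^ α) * muAlpha d α (closedBall x r) := by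
    rw [hB', Measure.addHaar_closedBall_center,
      ← Measure.addHaar_closedBall_center (volume : Measure (EuclideanSpace ℝ (Fin d))) x]
    refine (volume_closedBall_le_muAlpha hd0 hα hx (min_le_right _ _)).trans ?_
    gcongr
    exact min_le_left _ _
  have hFm : Measurable fun y : EuclideanSpace ℝ (Fin d) => F ‖y‖ := by fun_prop
  have hm1 := measurable_radialMeasure_ray (d - 1 - α) hBm
  have hm2 := measurable_radialMeasure_ray (d - 1) hB'm
  have hm12 : Measurable fun ω : sphere (0 : EuclideanSpace ℝ (Fin d)) 1 =>
      radialMeasure (d - 1 - α)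
          ((fun t : ℝ => t • (ω : EuclideanSpace ℝ (Fin d))) ⁻¹' closedBall x r) +
        K * radialMeasure (d - 1) ((fun t : ℝ => t • (ω : EuclideanSpace ℝ (Fin d))) ⁻¹' B') :=
    hm1.add (hm2.const_mul K)
  have hvol' : volume B' = ∫⁻ ω, radialMeasure (d - 1)
      ((fun t : ℝ => t • (ω : EuclideanSpace ℝ (Fin d))) ⁻¹' B')
      ∂(volume : Measure (EuclideanSpace ℝ (Fin d))).toSphere := by
    rw [← muAlpha_zero, muAlpha_apply hd0 0 hB'm, sub_zero, muAlpha_zero]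
  calc ∫⁻ y in closedBall x r, F ‖y‖ ∂muAlpha d α
      = ∫⁻ y, (closedBall x r).indicator (fun y => F ‖y‖) y ∂muAlpha d α :=
        (lintegral_indicator hBm _).symm
    _ = _ := lintegral_muAlpha hd0 α (hFm.indicator hBm)
    _ ≤ ∫⁻ ω, c * (radialMeasure (d - 1 - α)
          ((fun t : ℝ => t • (ω : EuclideanSpace ℝ (Fin d))) ⁻¹' closedBall x r) +
        K * radialMeasure (d - 1) ((fun t : ℝ => t • (ω : EuclideanSpace ℝ (Fin d))) ⁻¹' B'))
        ∂(volume : Measure (EuclideanSpace ℝ (Fin d))).toSphere := lintegral_mono fun ω =>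
        lintegral_ray_le hα hd hx (by simp) hr hs hs2 h
    _ = c * (muAlpha d α (closedBall x r) + K * volume B') := by
        rw [lintegral_const_mul _ hm12, lintegral_add_left hm1,
          lintegral_const_mul _ hm2, muAlpha_apply hd0 α hBm, hvol']
    _ ≤ c * (muAlpha d α (closedBall x r) +
          K * (ENNReal.ofReal ((2 * ‖x‖) ^ α) * muAlpha d α (closedBall x r))) := by gcongr
    _ ≤ c * (muAlpha d α (closedBall x r) +
          ENNReal.ofReal (4 * (6 : ℝ) ^ (α / 2)) * muAlpha d α (closedBall x r)) := by
        rw [← mul_assoc K, hK, ← ENNReal.ofReal_mul (by positivity)]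
        gcongr c * (_ + ENNReal.ofReal ?_ * _)
        exact two_mul_rpow_mul_rpow_le hR hα
    _ = _ := by
        rw [ENNReal.ofReal_add (by positivity) zero_le_one, ENNReal.ofReal_one, add_mul, one_mul,
          add_comm]

/-- The corollary: for fixed `α > 0` and any dimension `d ≥ 2α`, the centered maximal operator
associated to `dμ_α(y) = ‖y‖₂^{-α} dy`, acting on radial functions, satisfies the weak type
`(1,1)` inequality `μ_α({M f > λ}) ≤ (2(4·6^{α/2} + 1)/λ)‖f‖₁`. -/
theorem corollary_weak_one_one (α : ℝ) (hα : 0 < α) (d : ℕ) (hd : 2 * α ≤ d)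
    (f : EuclideanSpace ℝ (Fin d) → ℝ) (hrad : IsRadial f)
    (hint : Integrable f (muAlpha d α)) (lam : ℝ) (hlam : 0 < lam) :
    (muAlpha d α) {x | ENNReal.ofReal lam < centeredMaximal (muAlpha d α) f x} ≤
      ENNReal.ofReal (2 * (4 * (6 : ℝ) ^ (α / 2) + 1) / lam) *
        ∫⁻ x, ENNReal.ofReal |f x| ∂(muAlpha d α) := by
  have hd0 : 0 < d := by
    have : (0 : ℝ) < d := by linarith
    exact_mod_cast this
  have : Nonempty (Fin d) := ⟨⟨0, hd0⟩⟩
  obtain ⟨F, hF, hfF⟩ := exists_measurable_profile hd0 hrad hint.1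
  set C : ℝ := 4 * (6 : ℝ) ^ (α / 2) + 1 with hC
  have hC0 : 0 < C := by positivity
  set m := radialMeasure (d - 1 - α) with hm
  have : IsLocallyFiniteMeasure m := isLocallyFiniteMeasure_radialMeasure (by linarith)
  set c := ENNReal.ofReal (lam / C) with hc
  have hc0 : c ≠ 0 := by simp only [hc, ne_eq, ENNReal.ofReal_eq_zero, not_le]; positivity
  have hcC : c * ENNReal.ofReal C = ENNReal.ofReal lam := by
    rw [hc, ← ENNReal.ofReal_mul (by positivity), div_mul_cancel₀ _ hC0.ne']
  set A₀ : Set ℝ := {R | ∃ a b, a ≤ R ∧ R ≤ b ∧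
    c * m (Set.Icc a b) < ∫⁻ t in Set.Icc a b, F t ∂m}
  have hA₀ : c * m A₀ ≤ 2 * ∫⁻ t, F t ∂m :=
    mul_measure_le_of_forall_Icc m hF hc0 ENNReal.ofReal_ne_top A₀ fun x hx => hx
  have hsub : {x | ENNReal.ofReal lam < centeredMaximal (muAlpha d α) f x} ⊆
      {0} ∪ (fun x => ‖x‖) ⁻¹' toMeasurable m A₀ := by
    intro x hx
    by_contra hcon
    simp only [Set.singleton_union, Set.mem_insert_iff, Set.mem_preimage, not_or] at hcon
    have hxA : ‖x‖ ∉ A₀ := fun hmem => hcon.2 (subset_toMeasurable _ _ hmem)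
    have hno : ∀ a b, a ≤ ‖x‖ → ‖x‖ ≤ b →
        ∫⁻ t in Set.Icc a b, F t ∂m ≤ c * m (Set.Icc a b) := by
      intro a b ha hb
      by_contra! hlt
      exact hxA ⟨a, b, ha, hb, hlt⟩
    rw [Set.mem_ofPred_eq] at hx
    refine absurd hx (not_lt.2 (iSup_le fun r => iSup_le fun hr => iSup_le fun hpos => ?_))
    have hle := setLIntegral_closedBall_le hd0 hα hd hF hcon.1 hr hno
    rw [← mul_assoc, ← hC, hcC, ← lintegral_congr_ae (ae_restrict_of_ae hfF)] at hle
    rw [mul_comm, ← div_eq_mul_inv]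
    exact ENNReal.div_le_of_le_mul hle
  set σ := (volume : Measure (EuclideanSpace ℝ (Fin d))).toSphere
  have hpolar : ∀ G : ℝ → ENNReal, Measurable G →
      ∫⁻ x, G ‖x‖ ∂muAlpha d α = σ Set.univ * ∫⁻ t, G t ∂m := by
    intro G hG
    rw [lintegral_muAlpha hd0 α (by fun_prop), mul_comm, ← lintegral_const]
    refine lintegral_congr fun ω => lintegral_congr_ae ?_
    filter_upwards [ae_radialMeasure_pos _] with t ht
    have hω : ‖(ω : EuclideanSpace ℝ (Fin d))‖ = 1 := by simp
    rw [norm_smul, hω, mul_one, Real.norm_of_nonneg ht.le]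
  have hzero : muAlpha d α {0} = 0 :=
    withDensity_absolutelyContinuous _ _ (measure_singleton _)
  have hAm : MeasurableSet (toMeasurable m A₀) := measurableSet_toMeasurable _ _
  have hmeas : muAlpha d α {x | ENNReal.ofReal lam < centeredMaximal (muAlpha d α) f x} ≤
      σ Set.univ * m A₀ := by
    refine (measure_mono hsub).trans ((measure_union_le _ _).trans ?_)
    rw [hzero, zero_add, ← lintegral_indicator_one (hAm.preimage measurable_norm)]
    refine (hpolar ((toMeasurable m A₀).indicator 1) (measurable_one.indicator hAm)).le.trans ?_
    rw [lintegral_indicator_one hAm, measure_toMeasurable]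
  have hA₀' : m A₀ ≤ c⁻¹ * (2 * ∫⁻ t, F t ∂m) := by
    rw [← ENNReal.div_eq_inv_mul, ENNReal.le_div_iff_mul_le (Or.inl hc0)
      (Or.inl ENNReal.ofReal_ne_top), mul_comm]
    exact hA₀
  have hconst : c⁻¹ * 2 = ENNReal.ofReal (2 * C / lam) := by
    rw [hc, ← ENNReal.ofReal_inv_of_pos (by positivity), ← ENNReal.ofReal_ofNat 2,
      ← ENNReal.ofReal_mul (by positivity), inv_div]
    congr 1
    ring
  rw [lintegral_congr_ae hfF, hpolar F hF]
  calc _ ≤ σ Set.univ * (c⁻¹ * (2 * ∫⁻ t, F t ∂m)) := hmeas.trans (by gcongr)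
    _ = (c⁻¹ * 2) * (σ Set.univ * ∫⁻ t, F t ∂m) := by ring
    _ = _ := by rw [hconst]
end

section
/- Fix α > 0 and let d be a dimension with d ≥ 2α, and let μ_α be the measure on ℝ^d with density dμ_α(y) = ‖y‖₂^{-α} dy. Then for every x ∈ ℝ^d with x ≠ 0 and every r with 0 < r ≤ 1, μ_α(B(x·√(1−r²), r·‖x‖₂)) ≤ 4·6^{α/2} · μ_α(B(x, r·‖x‖₂)). -/
open MeasureTheory Metric

theorem muAlpha_ball (d : ℕ) (α : ℝ) (c : EuclideanSpace ℝ (Fin d)) (ρ : ℝ) :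
    muAlpha d α (ball c ρ) = ∫⁻ y in ball c ρ, ENNReal.ofReal (‖y‖ ^ (-α)) :=
  withDensity_apply _ measurableSet_ball

theorem lintegral_ball_norm_rpow_neg_le_of_add_le_norm {E : Type*} [NormedAddCommGroup E]
    [MeasurableSpace E] [OpensMeasurableSpace E] (μ : Measure E) {α ρ δ : ℝ} (hα : 0 < α)
    (hδ : 0 < δ) (c : E) (h : δ + ρ ≤ ‖c‖) :
    ∫⁻ y in ball c ρ, ENNReal.ofReal (‖y‖ ^ (-α)) ∂μ ≤
      ENNReal.ofReal (δ ^ (-α)) * μ (ball c ρ) := by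
  rw [← setLIntegral_const]
  refine setLIntegral_mono' measurableSet_ball fun y hy => ENNReal.ofReal_le_ofReal ?_
  refine Real.rpow_le_rpow_of_nonpos hδ ?_ (by linarith)
  rw [mem_ball'] at hy
  have := norm_sub_norm_le c y
  rw [← dist_eq_norm] at this
  linarith

section AddHaar

variable {E : Type*} [NormedAddCommGroup E] [NormedSpace ℝ E] [FiniteDimensional ℝ E]
  [MeasurableSpace E] [BorelSpace E] (μ : Measure E) [μ.IsAddHaarMeasure]

theorem measure_lt_norm_rpow_neg_le {α t : ℝ} (hα : 0 < α) (ht : 0 < t) :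
    μ {y | t < ‖y‖ ^ (-α)} ≤
      ENNReal.ofReal (t ^ (-((Module.finrank ℝ E : ℝ) / α))) * μ (ball 0 1) := by
  have hsub : {y : E | t < ‖y‖ ^ (-α)} ⊆ ball 0 (t ^ (-α⁻¹)) := by
    intro y hy
    rw [Set.mem_ofPred_eq] at hy
    have hy0 : 0 < ‖y‖ := by
      refine (norm_nonneg y).lt_of_ne fun h => ?_
      rw [← h, Real.zero_rpow (neg_ne_zero.2 hα.ne')] at hy
      exact hy.not_gt ht
    rw [mem_ball_zero_iff]
    have h := Real.rpow_lt_rpow_of_neg ht hy (neg_neg_of_pos (inv_pos.2 hα))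
    rwa [← Real.rpow_mul hy0.le, neg_mul_neg, mul_inv_cancel₀ hα.ne', Real.rpow_one] at h
  refine (measure_mono hsub).trans_eq ?_
  rw [Measure.addHaar_ball_of_pos μ _ (by positivity), ← Real.rpow_natCast, ← Real.rpow_mul ht.le]
  congr 3
  ring

/-- A ball of radius `ρ` has at most twice the mass it would have with constant
density `ρ ^ (-α)`. -/
theorem lintegral_ball_norm_rpow_neg_le {α ρ : ℝ} (hα : 0 < α)
    (hd : 2 * α ≤ Module.finrank ℝ E) (c : E) (hρ : 0 < ρ) :
    ∫⁻ y in ball c ρ, ENNReal.ofReal (‖y‖ ^ (-α)) ∂μ ≤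
      ENNReal.ofReal (2 * ρ ^ (-α)) * μ (ball c ρ) := by
  set D : ℝ := (Module.finrank ℝ E : ℝ) with hD
  have hT : 0 < ρ ^ (-α) := by positivity
  have hDα : 2 ≤ D / α := by rwa [le_div_iff₀ hα]
  have hmeas : Measurable fun y : E => ‖y‖ ^ (-α) := by fun_prop
  rw [lintegral_eq_lintegral_meas_lt _ (.of_forall fun y => by positivity) hmeas.aemeasurable,
    ← Set.Ioc_union_Ioi_eq_Ioi hT.le]
  refine (lintegral_union_le _ _ _).trans ?_
  have hlow : ∫⁻ t in Set.Ioc 0 (ρ ^ (-α)), μ.restrict (ball c ρ) {y | t < ‖y‖ ^ (-α)} ≤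
      ENNReal.ofReal (ρ ^ (-α)) * μ (ball c ρ) := by
    refine (lintegral_mono (g := fun _ => μ (ball c ρ)) fun t => ?_).trans_eq ?_
    · exact (measure_mono (Set.subset_univ _)).trans_eq (Measure.restrict_apply_univ _)
    · rw [setLIntegral_const, Real.volume_Ioc, sub_zero, mul_comm]
  have hhigh : ∫⁻ t in Set.Ioi (ρ ^ (-α)), μ.restrict (ball c ρ) {y | t < ‖y‖ ^ (-α)} ≤
      ENNReal.ofReal (ρ ^ (-α)) * μ (ball c ρ) := by
    calc ∫⁻ t in Set.Ioi (ρ ^ (-α)), μ.restrict (ball c ρ) {y | t < ‖y‖ ^ (-α)}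
        ≤ ∫⁻ t in Set.Ioi (ρ ^ (-α)), ENNReal.ofReal (t ^ (-(D / α))) * μ (ball 0 1) :=
          setLIntegral_mono' measurableSet_Ioi fun t ht =>
            (Measure.restrict_apply_le _ _).trans
              (measure_lt_norm_rpow_neg_le μ hα (hT.trans ht))
      _ = ENNReal.ofReal (∫ t in Set.Ioi (ρ ^ (-α)), t ^ (-(D / α))) * μ (ball 0 1) := by
          rw [lintegral_mul_const _ (by fun_prop), ofReal_integral_eq_lintegral_ofReal
            (integrableOn_Ioi_rpow_of_lt (by linarith) hT)]
          exact (ae_restrict_mem measurableSet_Ioi).mono fun t ht =>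
            Real.rpow_nonneg (hT.trans ht).le _
      _ ≤ ENNReal.ofReal (ρ ^ (-α)) * μ (ball c ρ) := by
          rw [Measure.addHaar_ball_of_pos μ c hρ, ← mul_assoc, ← ENNReal.ofReal_mul hT.le]
          gcongr
          rw [integral_Ioi_rpow_of_lt (by linarith) hT, ← Real.rpow_natCast,
            ← Real.rpow_mul hρ.le, ← Real.rpow_add hρ, ← hD]
          have hexp : -α * (-(D / α) + 1) = -α + D := by field_simp; ring
          rw [hexp, neg_div, ← div_neg]
          exact div_le_self (by positivity) (by linarith)
  refine (add_le_add hlow hhigh).trans_eq ?_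
  rw [← two_mul, ← mul_assoc, ENNReal.ofReal_mul zero_le_two, ENNReal.ofReal_ofNat]

end AddHaar

section Inner

variable {E : Type*} [NormedAddCommGroup E] [InnerProductSpace ℝ E] [FiniteDimensional ℝ E]
  [MeasurableSpace E] [BorelSpace E]

/-- At least half of `ball x ρ` lies in the centered ball of squared radius `‖x‖ ^ 2 + ρ ^ 2`. -/
theorem measure_ball_le_two_mul (μ : Measure E) [μ.IsAddHaarMeasure] (x : E) (ρ : ℝ) :
    μ (ball x ρ) ≤ 2 * μ (ball x ρ ∩ {y | ‖y‖ ^ 2 ≤ ‖x‖ ^ 2 + ρ ^ 2}) := by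
  set S := ball x ρ ∩ {y | ‖y‖ ^ 2 ≤ ‖x‖ ^ 2 + ρ ^ 2} with hS
  have hcover : ball x ρ ⊆ S ∪ (fun y => (x + x) - y) ⁻¹' S := by
    intro y hy
    by_cases h : y ∈ S
    · exact .inl h
    refine .inr ?_
    have hyx : ‖y - x‖ < ρ := mem_ball_iff_norm.1 hy
    have hz : ‖(x + x) - y - x‖ = ‖y - x‖ := by
      rw [← norm_neg]; congr 1; abel
    have hpar := parallelogram_law_with_norm ℝ x (y - x)
    rw [add_sub_cancel, show x - (y - x) = x + x - y by abel] at hpar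
    have hlt : ‖x‖ ^ 2 + ρ ^ 2 < ‖y‖ ^ 2 := not_le.1 fun h' => h ⟨hy, h'⟩
    refine ⟨mem_ball_iff_norm.2 (hz.trans_lt hyx), ?_⟩
    rw [Set.mem_ofPred_eq]
    nlinarith [norm_nonneg (y - x)]
  refine (measure_mono hcover).trans ((measure_union_le _ _).trans_eq ?_)
  have hSm : MeasurableSet S :=
    measurableSet_ball.inter (measurableSet_le (by fun_prop) (by fun_prop))
  rw [(Measure.measurePreserving_sub_left μ (x + x)).measure_preimage hSm.nullMeasurableSet, two_mul]

theorem le_lintegral_ball_norm_rpow_neg (μ : Measure E) [μ.IsAddHaarMeasure] {α ρ : ℝ}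
    (hα : 0 < α) {x : E} (hρ : ρ ≤ ‖x‖) :
    ENNReal.ofReal ((‖x‖ ^ 2 + ρ ^ 2) ^ (-(α / 2))) * μ (ball x ρ) ≤
      2 * ∫⁻ y in ball x ρ, ENNReal.ofReal (‖y‖ ^ (-α)) ∂μ := by
  have hSm : MeasurableSet {y : E | ‖y‖ ^ 2 ≤ ‖x‖ ^ 2 + ρ ^ 2} :=
    measurableSet_le (by fun_prop) (by fun_prop)
  refine (mul_le_mul_right (measure_ball_le_two_mul μ x ρ) _).trans ?_
  rw [mul_left_comm, ← setLIntegral_const]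
  gcongr 2 * ?_
  refine (setLIntegral_mono' (measurableSet_ball.inter hSm) fun y hy => ?_).trans
    (lintegral_mono_set Set.inter_subset_left)
  have hy0 : 0 < ‖y‖ := by
    refine norm_pos_iff.2 fun h => ?_
    have := hy.1
    rw [h, mem_ball', dist_zero_right] at this
    linarith
  refine ENNReal.ofReal_le_ofReal ?_
  have h := Real.rpow_le_rpow_of_nonpos (by positivity) hy.2 (by linarith : -(α / 2) ≤ 0)
  rwa [← Real.rpow_natCast ‖y‖, ← Real.rpow_mul hy0.le,
    show ((2 : ℕ) : ℝ) * -(α / 2) = -α by push_cast; ring] at h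

end Inner

theorem sqrt_five_add_le_sqrt_one_sub_sq {r : ℝ} (hr : 5 * r ^ 2 ≤ 1) :
    Real.sqrt 5 + 5 * r ≤ 5 * Real.sqrt (1 - r ^ 2) := by
  have h5 : Real.sqrt 5 ^ 2 = 5 := Real.sq_sqrt (by norm_num)
  have h5' := Real.sqrt_nonneg 5
  have hr' : 5 * r ≤ Real.sqrt 5 := by
    apply Real.le_sqrt_of_sq_le
    nlinarith
  have hs : 2 * Real.sqrt 5 / 5 ≤ Real.sqrt (1 - r ^ 2) := by
    apply Real.le_sqrt_of_sq_le
    nlinarith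
  linarith

/-- The ball-shifting estimate of the corollary: for `α > 0`, `d ≥ 2α`, `x ≠ 0` and `0 < r ≤ 1`,
`μ_α(B(x√(1−r²), r‖x‖₂)) ≤ 4·6^{α/2} μ_α(B(x, r‖x‖₂))`. -/
theorem shifted_ball_estimate (α : ℝ) (hα : 0 < α) (d : ℕ) (hd : 2 * α ≤ d)
    (x : EuclideanSpace ℝ (Fin d)) (hx : x ≠ 0) (r : ℝ) (hr₀ : 0 < r) (hr₁ : r ≤ 1) :
    muAlpha d α (ball (Real.sqrt (1 - r ^ 2) • x) (r * ‖x‖)) ≤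
      ENNReal.ofReal (4 * (6 : ℝ) ^ (α / 2)) * muAlpha d α (ball x (r * ‖x‖)) := by
  have hn : 0 < ‖x‖ := norm_pos_iff.2 hx
  have hρ : 0 < r * ‖x‖ := by positivity
  set c := Real.sqrt (1 - r ^ 2) • x with hc
  set ρ := r * ‖x‖ with hρ_def
  set q := ‖x‖ ^ 2 + ρ ^ 2 with hq
  have hq0 : 0 < q := by positivity
  have hsq (t : ℝ) (ht : 0 < t) : t ^ (-α) = (t ^ 2) ^ (-(α / 2)) := by
    rw [← Real.rpow_natCast t, ← Real.rpow_mul ht.le]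
    congr 1
    push_cast; ring
  have hcmp (t : ℝ) (ht : 0 < t) (h : q ≤ 6 * t ^ 2) :
      t ^ (-α) ≤ 6 ^ (α / 2) * q ^ (-(α / 2)) := by
    have h' := Real.rpow_le_rpow_of_nonpos hq0 h (by linarith : -(α / 2) ≤ 0)
    rw [Real.mul_rpow (by norm_num) (by positivity), ← hsq t ht, Real.rpow_neg (by norm_num)] at h'
    rwa [inv_mul_le_iff₀ (by positivity)] at h'
  have hupper : muAlpha d α (ball c ρ) ≤
      ENNReal.ofReal (2 * (6 ^ (α / 2) * q ^ (-(α / 2)))) * volume (ball c ρ) := by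
    rw [muAlpha_ball]
    rcases le_total (5 * r ^ 2) 1 with hr | hr
    · have h5 : Real.sqrt 5 ^ 2 = 5 := Real.sq_sqrt (by norm_num)
      set δ := Real.sqrt 5 / 5 * ‖x‖ with hδ
      have hδ0 : 0 < δ := by positivity
      have hδc : δ + ρ ≤ ‖c‖ := by
        rw [hc, norm_smul, Real.norm_of_nonneg (Real.sqrt_nonneg _), hδ, hρ_def, ← add_mul]
        have := sqrt_five_add_le_sqrt_one_sub_sq hr
        gcongr
        linarith
      refine (lintegral_ball_norm_rpow_neg_le_of_add_le_norm volume hα hδ0 c hδc).trans ?_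
      gcongr
      have hle : q ≤ 6 * δ ^ 2 := by
        rw [hq, hδ, hρ_def, mul_pow, mul_pow, div_pow, h5]
        nlinarith [sq_nonneg ‖x‖]
      have := hcmp δ hδ0 hle
      have : 0 < (6 : ℝ) ^ (α / 2) * q ^ (-(α / 2)) := by positivity
      linarith
    · refine (lintegral_ball_norm_rpow_neg_le volume hα (by simpa using hd) c hρ).trans ?_
      gcongr
      refine hcmp ρ hρ ?_
      rw [hq, hρ_def, mul_pow]
      nlinarith [sq_nonneg ‖x‖]
  have hlower := le_lintegral_ball_norm_rpow_neg volume hα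
    (show ρ ≤ ‖x‖ from mul_le_of_le_one_left hn.le hr₁)
  rw [← muAlpha_ball] at hlower
  rw [Measure.addHaar_ball_center volume c, ← Measure.addHaar_ball_center volume x, ← mul_assoc,
    ENNReal.ofReal_mul (by positivity), mul_assoc] at hupper
  calc muAlpha d α (ball c ρ)
      ≤ ENNReal.ofReal (2 * 6 ^ (α / 2)) *
        (ENNReal.ofReal (q ^ (-(α / 2))) * volume (ball x ρ)) := hupper
    _ ≤ ENNReal.ofReal (2 * 6 ^ (α / 2)) * (2 * muAlpha d α (ball x ρ)) := by gcongr
    _ = ENNReal.ofReal (4 * (6 : ℝ) ^ (α / 2)) * muAlpha d α (ball x ρ) := by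
      rw [← mul_assoc, show (4 : ℝ) * 6 ^ (α / 2) = 2 * 6 ^ (α / 2) * 2 by ring,
        ENNReal.ofReal_mul (by positivity : (0 : ℝ) ≤ 2 * 6 ^ (α / 2)), ENNReal.ofReal_ofNat]
end

section
/- Let α > 0, let d ≥ 1, and let μ_α be the measure on ℝ^d with density dμ_α(y) = ‖y‖₂^{-α} dy. Then for every x ∈ ℝ^d with x ≠ 0 and every r > 0, μ_α(B(x, r·‖x‖₂)) ≥ v_d · (r·‖x‖₂)^d / (2·‖x‖₂^α·(1+r²)^{α/2}), where v_d is the Lebesgue measure of the unit ball of ℝ^d. (Indeed, at least half of the ball B(x, r·‖x‖₂), in Lebesgue measure, is contained in the set {y : ‖y‖₂ ≤ ‖x‖₂·√(1+r²)}, on which the density ‖y‖₂^{-α} is at least (‖x‖₂·√(1+r²))^{-α}.) -/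
open MeasureTheory Metric

open scoped RealInnerProductSpace

/-- A half of a ball cut off by a hyperplane through its center has at least half the measure. -/
theorem measure_ball_le_two_mul_measure_ball_inter_halfSpace {E : Type*}
    [NormedAddCommGroup E] [InnerProductSpace ℝ E] [MeasurableSpace E] [BorelSpace E]
    (μ : Measure E) [μ.IsAddLeftInvariant] [μ.IsNegInvariant] (x v : E) (s : ℝ) :
    μ (ball x s) ≤ 2 * μ (ball x s ∩ {y | ⟪y - x, v⟫ ≤ 0}) := by
  set H : Set E := ball x s ∩ {y | ⟪y - x, v⟫ ≤ 0}
  have hrefl : μ ((fun y => x + x - y) ⁻¹' H) = μ H := by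
    have hcomp : (fun y : E => x + x - y) ⁻¹' H = -((fun y => x + x + y) ⁻¹' H) := by
      ext y
      simp [sub_eq_add_neg]
    rw [hcomp, Measure.measure_neg, measure_preimage_add]
  have hcover : ball x s ⊆ H ∪ (fun y => x + x - y) ⁻¹' H := by
    intro y hy
    rcases le_total ⟪y - x, v⟫ 0 with h | h
    · exact Or.inl ⟨hy, h⟩
    · have hsub : x + x - y - x = -(y - x) := by abel
      refine Or.inr ⟨?_, ?_⟩
      · rw [mem_ball, dist_eq_norm] at hy ⊢
        rwa [hsub, norm_neg]
      · simp only [Set.mem_ofPred_eq, hsub, inner_neg_left]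
        linarith
  calc μ (ball x s) ≤ μ (H ∪ (fun y => x + x - y) ⁻¹' H) := measure_mono hcover
    _ ≤ μ H + μ ((fun y => x + x - y) ⁻¹' H) := measure_union_le _ _
    _ = 2 * μ H := by rw [hrefl, two_mul]

/-- A point `y` within distance `r * ‖x‖` of `x` whose displacement from `x` makes a non-acute
angle with `x` has norm at most `‖x‖ * √(1 + r ^ 2)`. -/
theorem norm_le_norm_mul_sqrt_of_inner_sub_nonpos {E : Type*}
    [NormedAddCommGroup E] [InnerProductSpace ℝ E] {x y : E} {r : ℝ}
    (hy : ‖y - x‖ ≤ r * ‖x‖) (h : ⟪y - x, x⟫ ≤ 0) : ‖y‖ ≤ ‖x‖ * √(1 + r ^ 2) := by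
  have hsq : ‖y‖ ^ 2 = ‖y - x‖ ^ 2 + 2 * ⟪y - x, x⟫ + ‖x‖ ^ 2 := by
    rw [← norm_add_sq_real, sub_add_cancel]
  have hle : ‖y - x‖ ^ 2 ≤ (r * ‖x‖) ^ 2 := by gcongr
  refine (sq_le_sq₀ (norm_nonneg y) (by positivity)).1 ?_
  rw [mul_pow, Real.sq_sqrt (by positivity)]
  linarith [mul_pow r ‖x‖ 2]

/-- The lower estimate of the corollary: for `α > 0`, `x ≠ 0` and `r > 0`,
`μ_α(B(x, r‖x‖₂)) ≥ v_d (r‖x‖₂)^d / (2‖x‖₂^α (1+r²)^{α/2})`, where `v_d` is the Lebesgue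
measure of the unit ball of `ℝ^d`. -/
theorem ball_measure_lower_bound (α : ℝ) (hα : 0 < α) (d : ℕ) (hd : 1 ≤ d)
    (x : EuclideanSpace ℝ (Fin d)) (hx : x ≠ 0) (r : ℝ) (hr : 0 < r) :
    ENNReal.ofReal ((r * ‖x‖) ^ d / (2 * ‖x‖ ^ α * (1 + r ^ 2) ^ (α / 2))) *
        volume (ball (0 : EuclideanSpace ℝ (Fin d)) 1) ≤
      muAlpha d α (ball x (r * ‖x‖)) := by
  have : Nonempty (Fin d) := ⟨⟨0, hd⟩⟩
  have hx0 : 0 < ‖x‖ := norm_pos_iff.2 hx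
  set H : Set (EuclideanSpace ℝ (Fin d)) :=
    ball x (r * ‖x‖) ∩ {y | ⟪y - x, x⟫ ≤ 0}
  have hHm : MeasurableSet H :=
    measurableSet_ball.inter (measurableSet_le (by fun_prop) measurable_const)
  set c : ℝ := (‖x‖ * √(1 + r ^ 2)) ^ (-α) with hc
  have hc_eq : c = (‖x‖ ^ α * (1 + r ^ 2) ^ (α / 2))⁻¹ := by
    rw [hc, Real.rpow_neg (by positivity), Real.mul_rpow hx0.le (by positivity),
      Real.sqrt_eq_rpow, ← Real.rpow_mul (by positivity)]
    ring_nf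
  have hdensity : ∀ y ∈ H \ {0}, ENNReal.ofReal c ≤ ENNReal.ofReal (‖y‖ ^ (-α)) := by
    rintro y ⟨⟨hyball, hyinner⟩, hy0⟩
    refine ENNReal.ofReal_le_ofReal (Real.rpow_le_rpow_of_nonpos (norm_pos_iff.2 hy0) ?_
      (by linarith))
    exact norm_le_norm_mul_sqrt_of_inner_sub_nonpos (mem_ball_iff_norm.1 hyball).le hyinner
  have hconst : (r * ‖x‖) ^ d / (2 * ‖x‖ ^ α * (1 + r ^ 2) ^ (α / 2)) =
      c * 2⁻¹ * (r * ‖x‖) ^ d := by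
    rw [hc_eq, div_eq_mul_inv, mul_assoc 2, mul_inv]
    ring
  have hball : volume (ball x (r * ‖x‖)) =
      ENNReal.ofReal ((r * ‖x‖) ^ d) * volume (ball (0 : EuclideanSpace ℝ (Fin d)) 1) := by
    rw [Measure.addHaar_ball _ _ (by positivity), finrank_euclideanSpace_fin]
  have hhalf : 2⁻¹ * volume (ball x (r * ‖x‖)) ≤ volume H := by
    rw [ENNReal.inv_mul_le_iff two_ne_zero ENNReal.ofNat_ne_top]
    exact measure_ball_le_two_mul_measure_ball_inter_halfSpace volume x x _
  calc ENNReal.ofReal ((r * ‖x‖) ^ d / (2 * ‖x‖ ^ α * (1 + r ^ 2) ^ (α / 2))) *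
        volume (ball (0 : EuclideanSpace ℝ (Fin d)) 1)
      = ENNReal.ofReal c * (2⁻¹ * volume (ball x (r * ‖x‖))) := by
        rw [hconst, hball, ENNReal.ofReal_mul (by positivity), ENNReal.ofReal_mul (by positivity),
          ENNReal.ofReal_inv_of_pos two_pos, ENNReal.ofReal_ofNat]
        ring
    _ ≤ ENNReal.ofReal c * volume H := by gcongr
    _ = ∫⁻ _ in H \ {0}, ENNReal.ofReal c := by
        rw [setLIntegral_const, measure_sdiff_null (measure_singleton 0)]
    _ ≤ ∫⁻ y in H \ {0}, ENNReal.ofReal (‖y‖ ^ (-α)) :=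
        setLIntegral_mono' (hHm.diff (measurableSet_singleton 0)) hdensity
    _ = muAlpha d α (H \ {0}) :=
        (withDensity_apply _ (hHm.diff (measurableSet_singleton 0))).symm
    _ ≤ muAlpha d α (ball x (r * ‖x‖)) :=
        measure_mono (Set.sdiff_subset.trans Set.inter_subset_left)
end
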